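/- Neither B_2 ∗ B_3 nor B_3 ∗ B_3 belongs to 𝓑; that is, no pentagonal fragment obtained by pasting B_2 with B_3, or B_3 with B_3, along pasting edges is a subgraph of any fullerene graph. -/

import Mathlib

namespace FG

/-- A combinatorial plane (spherically embedded) graph: a finite simple graph together with
its collection of faces, each face recorded as the finset of edges of its boundary cycle.
Every face boundary is a cycle, every edge lies on exactly two faces, and Euler's formula
holds (edges are counted via the face incidences). -/
structure PlaneGraph (V : Type) [Fintype V] [DecidableEq V] : Type where
  graph : SimpleGraph V
  faces : Finset (Finset (Sym2 V))
  face_edges : ∀ f ∈ faces, ∀ e ∈ f, e ∈ graph.edgeSet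
  face_cycle : ∀ f ∈ faces, ∃ (v : V) (c : graph.Walk v v), c.IsCycle ∧ c.edges.toFinset = f
  edge_faces : ∀ e ∈ graph.edgeSet, (faces.filter (fun f => e ∈ f)).card = 2
  euler : 2 * (Fintype.card V + faces.card) = (∑ f ∈ faces, f.card) + 4

variable {V : Type} [Fintype V] [DecidableEq V]

/-- The vertices incident with at least one edge of an edge set. -/
def edgeVerts (E : Finset (Sym2 V)) : Finset V :=
  Finset.univ.filter fun v => ∃ e ∈ E, v ∈ e

/-- The degree of a vertex in the subgraph spanned by an edge set. -/
def deg (E : Finset (Sym2 V)) (v : V) : ℕ := (E.filter fun e => v ∈ e).card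

/-- The vertices covered by a collection of faces. -/
def facesVerts (H : Finset (Finset (Sym2 V))) : Finset V := edgeVerts (H.sup id)

/-- An edge set is a matching: non-loop edges, pairwise vertex-disjoint. -/
def IsMatching (M : Finset (Sym2 V)) : Prop :=
  (∀ e ∈ M, ¬e.IsDiag) ∧ ∀ e ∈ M, ∀ e' ∈ M, e ≠ e' → ∀ v : V, v ∈ e → v ∉ e'

/-- A fullerene graph: a cubic 3-connected plane graph with (exactly 12) pentagonal
faces and hexagonal faces. -/
structure IsFullerene (P : PlaneGraph V) : Prop where
  cubic : ∀ v : V, (P.graph.neighborSet v).ncard = 3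
  threeConnected : ∀ s : Set V, s.ncard ≤ 2 → (SimpleGraph.induce sᶜ P.graph).Connected
  faceSize : ∀ f ∈ P.faces, f.card = 5 ∨ f.card = 6
  pentTwelve : (P.faces.filter fun f => f.card = 5).card = 12

/-- A fragment of a plane graph: a nonempty set of faces (a cycle together with its
interior) whose boundary — the set of edges lying on exactly one chosen face — is a
single cycle. -/
structure Fragment (P : PlaneGraph V) : Type where
  inFaces : Finset (Finset (Sym2 V))
  nonempty : inFaces.Nonempty
  subFaces : inFaces ⊆ P.faces
  boundary_cycle : ∃ (v : V) (c : P.graph.Walk v v), c.IsCycle ∧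
    c.edges.toFinset =
      (inFaces.sup id).filter fun e => (inFaces.filter fun f => e ∈ f).card = 1

/-- The edge set of a fragment. -/
def Fragment.edges {P : PlaneGraph V} (B : Fragment P) : Finset (Sym2 V) := B.inFaces.sup id

/-- The boundary edges of a fragment. -/
def Fragment.boundary {P : PlaneGraph V} (B : Fragment P) : Finset (Sym2 V) :=
  B.edges.filter fun e => (B.inFaces.filter fun f => e ∈ f).card = 1

/-- A pentagonal fragment: all inner faces are pentagons. -/
def IsPentagonalFragment {P : PlaneGraph V} (B : Fragment P) : Prop :=
  ∀ f ∈ B.inFaces, f.card = 5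

/-- The faces of `P` adjoining the subgraph with edge set `E`: not a face of the
subgraph, but sharing at least one edge with it. -/
def adjoiningFaces (P : PlaneGraph V) (E : Finset (Sym2 V)) : Finset (Finset (Sym2 V)) :=
  P.faces.filter fun f => ¬f ⊆ E ∧ (f ∩ E).Nonempty

/-- The territory `T[G]` of the subgraph with edge set `E`: the subgraph together with
all adjoining faces. -/
def territoryEdges (P : PlaneGraph V) (E : Finset (Sym2 V)) : Finset (Sym2 V) :=
  E ∪ (adjoiningFaces P E).sup id

/-- `w(G)`: the number of 2-degree vertices of the subgraph spanned by `E`. -/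
def wcount (E : Finset (Sym2 V)) : ℕ := ((edgeVerts E).filter fun v => deg E v = 2).card

/-- A subgraph is maximal in `P` when its hexagon extension is contained in `P`,
i.e. every adjoining face is a hexagon. -/
def IsMaximalIn (P : PlaneGraph V) (E : Finset (Sym2 V)) : Prop :=
  ∀ f ∈ adjoiningFaces P E, f.card = 6

/-- `H ∈ 𝒮(G)` for the subgraph `G` with edge set `E`: `H` is a set of mutually disjoint
hexagons of the hexagon extension `H[G]` (hexagonal faces sharing at least one edge with
`G`) such that `G − H` has a matching covering all remaining 3-degree vertices of `G`. -/
def SextetAdm (P : PlaneGraph V) (E : Finset (Sym2 V)) (H : Finset (Finset (Sym2 V))) : Prop :=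
  (∀ f ∈ H, f ∈ P.faces ∧ f.card = 6 ∧ (f ∩ E).Nonempty) ∧
  (∀ f ∈ H, ∀ g ∈ H, f ≠ g → Disjoint (edgeVerts f) (edgeVerts g)) ∧
  ∃ M : Finset (Sym2 V), M ⊆ E ∧ IsMatching M ∧
    (∀ e ∈ M, ∀ v : V, v ∈ e → v ∉ facesVerts H) ∧
    ∀ v ∈ edgeVerts E, deg E v = 3 → v ∉ facesVerts H → ∃ e ∈ M, v ∈ e

/-- `U_H(G) = V(G) ∖ V(H)`. -/
def Uset (E : Finset (Sym2 V)) (H : Finset (Finset (Sym2 V))) : Finset V :=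
  edgeVerts E \ facesVerts H

/-- A Clar set of `H[G]`: a member of `𝒮(G)` minimizing `|U_H(G)|`. -/
def IsClarSet (P : PlaneGraph V) (E : Finset (Sym2 V)) (H : Finset (Finset (Sym2 V))) : Prop :=
  SextetAdm P E H ∧ ∀ H', SextetAdm P E H' → (Uset E H).card ≤ (Uset E H').card

/-- A normal Clar set: a Clar set such that `G − H` has a perfect matching. -/
def IsNormalClarSet (P : PlaneGraph V) (E : Finset (Sym2 V))
    (H : Finset (Finset (Sym2 V))) : Prop :=
  IsClarSet P E H ∧ ∃ M : Finset (Sym2 V), M ⊆ E ∧ IsMatching M ∧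
    (∀ e ∈ M, ∀ v : V, v ∈ e → v ∉ facesVerts H) ∧
    ∀ v ∈ Uset E H, ∃ e ∈ M, v ∈ e

/-- The pentagonal faces of the subgraph with edge set `E`. -/
def pentFaces (P : PlaneGraph V) (E : Finset (Sym2 V)) : Finset (Finset (Sym2 V)) :=
  P.faces.filter fun f => f.card = 5 ∧ f ⊆ E

/-- A subgraph with `k` pentagons is extremal if `|U_H(G)| = k` for a Clar set `H`. -/
def IsExtremalSub (P : PlaneGraph V) (E : Finset (Sym2 V)) : Prop :=
  ∃ H, IsClarSet P E H ∧ (Uset E H).card = (pentFaces P E).card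

/-- A pentagonal ring `R_k`: `k` pentagonal faces `R 0, …, R (k-1)` such that
`R i` and `R j` intersect iff `|i − j| = 1 (mod k)`. -/
def IsPentRing (P : PlaneGraph V) (k : ℕ) (R : ZMod k → Finset (Sym2 V)) : Prop :=
  Function.Injective R ∧ (∀ i, R i ∈ P.faces ∧ (R i).card = 5) ∧
  ∀ i j : ZMod k, i ≠ j →
    ((edgeVerts (R i) ∩ edgeVerts (R j)).Nonempty ↔ (j = i + 1 ∨ i = j + 1))

/-- The number of pentagons of the pentagonal fragment `B` adjoining (sharing an edge
with) the pentagon `p`. -/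
def pentAdjCount {P : PlaneGraph V} (B : Fragment P) (p : Finset (Sym2 V)) : ℕ :=
  (B.inFaces.filter fun q => q ≠ p ∧ (q ∩ p).Nonempty).card

/-- The fragment consisting of a single pentagon `P`. -/
def IsPentagonFrag {P : PlaneGraph V} (B : Fragment P) : Prop :=
  IsPentagonalFragment B ∧ B.inFaces.card = 1

/-- `B_2`: the extremal pentagonal fragment with 4 pentagons whose Clar extension is
normal. -/
def IsB2Frag {P : PlaneGraph V} (B : Fragment P) : Prop :=
  IsPentagonalFragment B ∧ B.inFaces.card = 4 ∧ IsExtremalSub P B.edges ∧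
    ∃ H, IsNormalClarSet P B.edges H

/-- `B_3`: the extremal pentagonal fragment with 6 pentagons whose Clar extension is
normal. -/
def IsB3Frag {P : PlaneGraph V} (B : Fragment P) : Prop :=
  IsPentagonalFragment B ∧ B.inFaces.card = 6 ∧ IsExtremalSub P B.edges ∧
    ∃ H, IsNormalClarSet P B.edges H

/-- A pasting edge of the subgraph with edge set `E`: an edge of `E` lying on the
boundary of the Clar extension `C[G]` (not an edge of a Clar hexagon) whose two
end-vertices belong to `V(H)` for a Clar set `H`. -/
def IsPastingEdge (P : PlaneGraph V) (E : Finset (Sym2 V)) (e : Sym2 V) : Prop :=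
  e ∈ E ∧ ∃ H, IsClarSet P E H ∧ (∀ v : V, v ∈ e → v ∈ facesVerts H) ∧ e ∉ H.sup id

/-- `B` arises from pasting `A` and `C` along a common pasting edge:
`B = A ∪ C` and `A ∩ C` is a single pasting edge of both. -/
def IsPasting {P : PlaneGraph V} (B A C : Fragment P) : Prop :=
  B.inFaces = A.inFaces ∪ C.inFaces ∧
  ∃ e : Sym2 V, A.edges ∩ C.edges = {e} ∧ IsPastingEdge P A.edges e ∧ IsPastingEdge P C.edges e

def IsBasicFrag {P : PlaneGraph V} (B : Fragment P) : Prop :=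
  IsPentagonFrag B ∨ IsB2Frag B ∨ IsB3Frag B

/-- The pentagonal fragments generated from `P`, `B_2`, `B_3` by the pasting operation. -/
inductive Pasted (P : PlaneGraph V) : Fragment P → Prop
  | base (B : Fragment P) : IsBasicFrag B → Pasted P B
  | paste (B A C : Fragment P) : Pasted P A → IsBasicFrag C → IsPasting B A C → Pasted P B

/-- `P ∗ P`. -/
def IsPPFrag {P : PlaneGraph V} (B : Fragment P) : Prop :=
  ∃ A C : Fragment P, IsPentagonFrag A ∧ IsPentagonFrag C ∧ IsPasting B A C

/-- `P ∗ B_2`. -/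
def IsPB2Frag {P : PlaneGraph V} (B : Fragment P) : Prop :=
  ∃ A C : Fragment P, IsPentagonFrag A ∧ IsB2Frag C ∧ IsPasting B A C

/-- `P ∗ B_2 ∗ P`. -/
def IsPB2PFrag {P : PlaneGraph V} (B : Fragment P) : Prop :=
  ∃ B' A C D : Fragment P, IsPentagonFrag A ∧ IsB2Frag C ∧ IsPentagonFrag D ∧
    IsPasting B' A C ∧ IsPasting B B' D

/-- The six members of `𝓑_{≥60}`. -/
def SixShapes {P : PlaneGraph V} (B : Fragment P) : Prop :=
  IsPentagonFrag B ∨ IsB2Frag B ∨ IsB3Frag B ∨ IsPPFrag B ∨ IsPB2Frag B ∨ IsPB2PFrag B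

/-- `B_1`: two vertex-disjoint pentagons joined by an edge. -/
def IsB1 (P : PlaneGraph V) (E : Finset (Sym2 V)) : Prop :=
  ∃ (f g : Finset (Sym2 V)) (a b : V), f ∈ P.faces ∧ g ∈ P.faces ∧ f.card = 5 ∧ g.card = 5 ∧
    Disjoint (edgeVerts f) (edgeVerts g) ∧ P.graph.Adj a b ∧
    a ∈ edgeVerts f ∧ b ∈ edgeVerts g ∧ E = f ∪ g ∪ {s(a, b)}

/-- `B_1^k`: `k` copies of `B_1` pasted together along pasting edges of their pentagons. -/
inductive B1Pow (P : PlaneGraph V) : ℕ → Finset (Sym2 V) → Prop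
  | one (E : Finset (Sym2 V)) : IsB1 P E → B1Pow P 1 E
  | succ (k : ℕ) (E X : Finset (Sym2 V)) (e : Sym2 V) (f g : Finset (Sym2 V)) :
      B1Pow P k E → IsB1 P X → E ∩ X = {e} → f ∈ P.faces → g ∈ P.faces →
      f.card = 5 → g.card = 5 → f ⊆ E → g ⊆ X → e ∈ f → e ∈ g →
      IsPastingEdge P f e → IsPastingEdge P g e → B1Pow P (k + 1) (E ∪ X)

/-- `F` contains `B_1^k` for some `2 ≤ k ≤ 4` as a subgraph. -/
def ContainsB1Pow (P : PlaneGraph V) : Prop :=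
  ∃ (k : ℕ) (E : Finset (Sym2 V)), 2 ≤ k ∧ k ≤ 4 ∧ B1Pow P k E

/-- A perfect matching of the plane graph `P`. -/
def IsPerfectMatching (P : PlaneGraph V) (M : Finset (Sym2 V)) : Prop :=
  (∀ e ∈ M, e ∈ P.graph.edgeSet) ∧ IsMatching M ∧ ∀ v : V, ∃ e ∈ M, v ∈ e

/-- A sextet pattern of `P`: mutually disjoint hexagonal faces, all alternating with
respect to a common perfect matching. -/
def IsSextetPattern (P : PlaneGraph V) (H : Finset (Finset (Sym2 V))) : Prop :=
  (∀ f ∈ H, f ∈ P.faces ∧ f.card = 6) ∧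
  (∀ f ∈ H, ∀ g ∈ H, f ≠ g → Disjoint (edgeVerts f) (edgeVerts g)) ∧
  ∃ M : Finset (Sym2 V), IsPerfectMatching P M ∧ ∀ f ∈ H, (f ∩ M).card = 3

/-- A Clar formula: a maximum sextet pattern. -/
def IsClarFormula (P : PlaneGraph V) (H : Finset (Finset (Sym2 V))) : Prop :=
  IsSextetPattern P H ∧ ∀ H', IsSextetPattern P H' → H'.card ≤ H.card

/-- An extremal fullerene graph: the Clar number equals `(n − 12)/6`. -/
def IsExtremalFullerene (P : PlaneGraph V) : Prop :=
  ∃ H, IsClarFormula P H ∧ 6 * H.card = Fintype.card V - 12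

/-- The edges of the union of all maximal pentagonal fragments of `P`. -/
noncomputable def maxPentEdges (P : PlaneGraph V) : Finset (Sym2 V) :=
  @Finset.filter _
    (fun e => ∃ B : Fragment P, IsPentagonalFragment B ∧ IsMaximalIn P B.edges ∧ e ∈ B.edges)
    (Classical.decPred _) (P.faces.sup id)

/-- The disjoint union of two copies of `K_2`. -/
def twoK2 : SimpleGraph (Fin 4) := SimpleGraph.fromEdgeSet {s(0, 1), s(2, 3)}

/-- The tree `T_0` on six vertices: two adjacent 3-degree vertices, each also adjacent
to two leaves. -/
def treeT0 : SimpleGraph (Fin 6) :=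
  SimpleGraph.fromEdgeSet {s(0, 1), s(0, 2), s(0, 3), s(1, 4), s(1, 5)}



/-! ### Local structure of faces at a vertex -/

/-- `x - y - z` is a corner of the face `f`. -/
def Cn (P : PlaneGraph V) (f : Finset (Sym2 V)) (x y z : V) : Prop :=
  f ∈ P.faces ∧ s(x, y) ∈ f ∧ s(y, z) ∈ f ∧ x ≠ z

theorem Cn.symm {P : PlaneGraph V} {f : Finset (Sym2 V)} {x y z : V} (h : Cn P f x y z) :
    Cn P f z y x := ⟨h.1, by rw [Sym2.eq_swap]; exact h.2.2.1, by rw [Sym2.eq_swap]; exact h.2.1,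
      h.2.2.2.symm⟩

theorem face_two (P : PlaneGraph V) {f : Finset (Sym2 V)} (hf : f ∈ P.faces) {x y : V}
    (h : s(x, y) ∈ f) : ∃ p q, p ≠ q ∧ ∀ w, s(y, w) ∈ f ↔ w = p ∨ w = q := by
  obtain ⟨v, c, hc, he⟩ := P.face_cycle f hf
  have hmem : ∀ e, e ∈ f ↔ e ∈ c.edges := by intro e; rw [← he]; simp
  have hy : y ∈ c.support := by
    have := (hmem _).1 h
    exact c.snd_mem_support_of_mem_edges this
  have h2 := hc.ncard_neighborSet_toSubgraph_eq_two hy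
  obtain ⟨p, q, hpq, hs⟩ := Set.ncard_eq_two.1 h2
  refine ⟨p, q, hpq, fun w => ?_⟩
  rw [hmem]
  have : w ∈ c.toSubgraph.neighborSet y ↔ w ∈ ({p, q} : Set V) := by rw [hs]
  rw [SimpleGraph.Subgraph.mem_neighborSet, SimpleGraph.Walk.adj_toSubgraph_iff_mem_edges] at this
  simpa using this

theorem Cn.ext (P : PlaneGraph V) {f : Finset (Sym2 V)} (hf : f ∈ P.faces) {x y : V}
    (h : s(x, y) ∈ f) : ∃ z, Cn P f x y z := by
  obtain ⟨p, q, hpq, hw⟩ := face_two P hf h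
  have hx := (hw x).1 (by rw [Sym2.eq_swap]; exact h)
  rcases hx with rfl | rfl
  · exact ⟨q, hf, h, (hw q).2 (Or.inr rfl), hpq⟩
  · exact ⟨p, hf, h, (hw p).2 (Or.inl rfl), hpq.symm⟩

theorem Cn.det {P : PlaneGraph V} {f : Finset (Sym2 V)} {x y z w : V} (h : Cn P f x y z)
    (h' : s(y, w) ∈ f) : w = x ∨ w = z := by
  obtain ⟨p, q, hpq, hw⟩ := face_two P h.1 h.2.1
  have h1 := (hw x).1 (by rw [Sym2.eq_swap]; exact h.2.1)
  have h2 := (hw z).1 h.2.2.1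
  have h3 := (hw w).1 h'
  have := h.2.2.2
  grind

theorem Cn.adj {P : PlaneGraph V} {f : Finset (Sym2 V)} {x y z : V} (h : Cn P f x y z) :
    P.graph.Adj y x ∧ P.graph.Adj y z := by
  have h1 := P.face_edges f h.1 _ h.2.1
  have h2 := P.face_edges f h.1 _ h.2.2.1
  rw [SimpleGraph.mem_edgeSet] at h1 h2
  exact ⟨h1.symm, h2⟩

theorem edge_two (P : PlaneGraph V) {x y : V} (h : P.graph.Adj x y) :
    ∃ f g, f ≠ g ∧ f ∈ P.faces ∧ g ∈ P.faces ∧ s(x, y) ∈ f ∧ s(x, y) ∈ g ∧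
      ∀ k ∈ P.faces, s(x, y) ∈ k → k = f ∨ k = g := by
  have := P.edge_faces s(x, y) (by simpa using h)
  obtain ⟨f, g, hfg, hs⟩ := Finset.card_eq_two.1 this
  have hm : ∀ k, k ∈ P.faces.filter (fun f => s(x, y) ∈ f) ↔ k = f ∨ k = g := by
    intro k; rw [hs]; simp
  simp only [Finset.mem_filter] at hm
  have hf := (hm f).2 (Or.inl rfl)
  have hg := (hm g).2 (Or.inr rfl)
  exact ⟨f, g, hfg, hf.1, hg.1, hf.2, hg.2, fun k hk hk' => (hm k).1 ⟨hk, hk'⟩⟩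

theorem nbrs (P : PlaneGraph V) (hP : IsFullerene P) {y a b c : V} (hab : a ≠ b) (hac : a ≠ c)
    (hbc : b ≠ c) (ha : P.graph.Adj y a) (hb : P.graph.Adj y b) (hc : P.graph.Adj y c)
    {w : V} (hw : P.graph.Adj y w) : w = a ∨ w = b ∨ w = c := by
  obtain ⟨p, q, r, h1, h2, h3, hs⟩ := Set.ncard_eq_three.1 (hP.cubic y)
  have hm : ∀ k, P.graph.Adj y k → k = p ∨ k = q ∨ k = r := by
    intro k hk
    have : k ∈ P.graph.neighborSet y := hk
    rw [hs] at this
    simpa using this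
  have := hm a ha
  have := hm b hb
  have := hm c hc
  have := hm w hw
  grind

theorem third_nbr (P : PlaneGraph V) (hP : IsFullerene P) {y a b : V} (hab : a ≠ b)
    (ha : P.graph.Adj y a) (hb : P.graph.Adj y b) :
    ∃ c, a ≠ c ∧ b ≠ c ∧ P.graph.Adj y c := by
  obtain ⟨p, q, r, h1, h2, h3, hs⟩ := Set.ncard_eq_three.1 (hP.cubic y)
  have hm : ∀ k, P.graph.Adj y k ↔ k = p ∨ k = q ∨ k = r := by
    intro k
    have : k ∈ P.graph.neighborSet y ↔ k ∈ ({p, q, r} : Set V) := by rw [hs]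
    simpa using this
  have h1 := (hm a).1 ha
  have h2 := (hm b).1 hb
  have := (hm p).2 (by simp)
  have := (hm q).2 (by simp)
  have := (hm r).2 (by simp)
  clear hm hs
  grind

theorem Cn.uniq {P : PlaneGraph V} (hP : IsFullerene P) {f g : Finset (Sym2 V)} {x y z : V}
    (hf : Cn P f x y z) (hg : Cn P g x y z) : f = g := by
  by_contra hne
  obtain ⟨c, h1, h2, hc⟩ := third_nbr P hP hf.2.2.2 hf.adj.1 hf.adj.2
  obtain ⟨k, k', hkk, hk, hk', hek, -, -⟩ := edge_two P hc
  obtain ⟨w, hw⟩ := Cn.ext P hk (x := c) (y := y) (by rw [Sym2.eq_swap]; exact hek)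
  have hwxz : w = x ∨ w = z := by
    rcases nbrs P hP hf.2.2.2 h1 h2 hf.adj.1 hf.adj.2 hc hw.adj.2 with h | h | h
    · exact Or.inl h
    · exact Or.inr h
    · exact absurd h.symm hw.2.2.2
  have key : k = f ∨ k = g := by
    rcases hwxz with rfl | rfl
    · obtain ⟨a, b, hab, -, -, -, -, hall⟩ := edge_two P hf.adj.1
      have e1 := hall f hf.1 (by rw [Sym2.eq_swap]; exact hf.2.1)
      have e2 := hall g hg.1 (by rw [Sym2.eq_swap]; exact hg.2.1)
      have e3 := hall k hw.1 hw.2.2.1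
      grind
    · obtain ⟨a, b, hab, -, -, -, -, hall⟩ := edge_two P hf.adj.2
      have e1 := hall f hf.1 hf.2.2.1
      have e2 := hall g hg.1 hg.2.2.1
      have e3 := hall k hw.1 hw.2.2.1
      grind
  have hcc : s(y, c) ∈ k := by rw [Sym2.eq_swap]; exact hw.2.1
  rcases key with rfl | rfl
  · rcases hf.det hcc with h | h
    · exact h1 h.symm
    · exact h2 h.symm
  · rcases hg.det hcc with h | h
    · exact h1 h.symm
    · exact h2 h.symm

/-- The corner rule at a vertex `y` with neighbours `x, z, w`. -/
theorem Cn.third {P : PlaneGraph V} (hP : IsFullerene P) {f g k : Finset (Sym2 V)} {x y z w : V}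
    (hf : Cn P f x y z) (hg : Cn P g x y w) (hfg : f ≠ g) (hk : k ∈ P.faces) (hz : s(y, z) ∈ k)
    (hkf : k ≠ f) : Cn P k z y w := by
  have hzw : z ≠ w := by
    rintro rfl
    exact hfg (hf.uniq hP hg)
  obtain ⟨p, hp⟩ := Cn.ext P hk (x := z) (y := y) (by rw [Sym2.eq_swap]; exact hz)
  rcases nbrs P hP hf.2.2.2 hg.2.2.2 hzw hf.adj.1 hf.adj.2 hg.adj.2 hp.adj.2 with h | h | h
  · subst h
    exact absurd (hp.symm.uniq hP hf) hkf
  · exact absurd h.symm hp.2.2.2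
  · subst h; exact hp

/-- Another way to say it: any face having the edge `y z` other than `f` has the third edge. -/
theorem Cn.other {P : PlaneGraph V} (hP : IsFullerene P) {f k : Finset (Sym2 V)} {x y z w : V}
    (hf : Cn P f x y z) (hw : P.graph.Adj y w) (hwx : w ≠ x) (hwz : w ≠ z)
    (hk : k ∈ P.faces) (hz : s(y, z) ∈ k)
    (hkf : k ≠ f) : Cn P k z y w := by
  obtain ⟨p, hp⟩ := Cn.ext P hk (x := z) (y := y) (by rw [Sym2.eq_swap]; exact hz)
  rcases nbrs P hP hf.2.2.2 hwx.symm hwz.symm hf.adj.1 hf.adj.2 hw hp.adj.2 with h | h | h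
  · subst h
    exact absurd (hp.symm.uniq hP hf) hkf
  · exact absurd h.symm hp.2.2.2
  · subst h; exact hp

theorem other_face (P : PlaneGraph V) {f : Finset (Sym2 V)} {x y : V} (hf : f ∈ P.faces)
    (h : s(x, y) ∈ f) : ∃ g ∈ P.faces, g ≠ f ∧ s(x, y) ∈ g ∧
      ∀ k ∈ P.faces, s(x, y) ∈ k → k = f ∨ k = g := by
  obtain ⟨a, b, hab, ha, hb, ha', hb', hall⟩ := edge_two P (x := x) (y := y)
    (by simpa using P.face_edges f hf _ h)
  rcases hall f hf h with rfl | rfl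
  · exact ⟨b, hb, hab.symm, hb', hall⟩
  · exact ⟨a, ha, hab, ha', fun k hk hk' => (hall k hk hk').symm⟩

/-- Explicit pentagon. -/
def Pent (P : PlaneGraph V) (f : Finset (Sym2 V)) (a b c d e : V) : Prop :=
  f ∈ P.faces ∧ f = {s(a, b), s(b, c), s(c, d), s(d, e), s(e, a)} ∧ [a, b, c, d, e].Nodup

/-- Explicit hexagon. -/
def Hexa (P : PlaneGraph V) (f : Finset (Sym2 V)) (a b c d e g : V) : Prop :=
  f ∈ P.faces ∧ f = {s(a, b), s(b, c), s(c, d), s(d, e), s(e, g), s(g, a)} ∧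
    [a, b, c, d, e, g].Nodup

theorem Pent.rot {P : PlaneGraph V} {f : Finset (Sym2 V)} {a b c d e : V} (h : Pent P f a b c d e) :
    Pent P f b c d e a := by
  obtain ⟨h1, h2, h3⟩ := h
  refine ⟨h1, ?_, ?_⟩
  · rw [h2]; ext e'; simp only [Finset.mem_insert, Finset.mem_singleton]; tauto
  · simp only [List.nodup_cons, List.mem_cons, List.not_mem_nil, not_or] at h3 ⊢
    grind

theorem Pent.flip {P : PlaneGraph V} {f : Finset (Sym2 V)} {a b c d e : V} (h : Pent P f a b c d e) :
    Pent P f b a e d c := by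
  obtain ⟨h1, h2, h3⟩ := h
  refine ⟨h1, ?_, ?_⟩
  · rw [h2, Sym2.eq_swap (a := b) (b := a), Sym2.eq_swap (a := a) (b := e),
      Sym2.eq_swap (a := e) (b := d), Sym2.eq_swap (a := d) (b := c),
      Sym2.eq_swap (a := c) (b := b)]
    ext e'; simp only [Finset.mem_insert, Finset.mem_singleton]; tauto
  · simp only [List.nodup_cons, List.mem_cons, List.not_mem_nil, not_or] at h3 ⊢
    grind

theorem Hexa.rot {P : PlaneGraph V} {f : Finset (Sym2 V)} {a b c d e g : V}
    (h : Hexa P f a b c d e g) : Hexa P f b c d e g a := by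
  obtain ⟨h1, h2, h3⟩ := h
  refine ⟨h1, ?_, ?_⟩
  · rw [h2]; ext e'; simp only [Finset.mem_insert, Finset.mem_singleton]; tauto
  · simp only [List.nodup_cons, List.mem_cons, List.not_mem_nil, not_or] at h3 ⊢
    grind

theorem Hexa.flip {P : PlaneGraph V} {f : Finset (Sym2 V)} {a b c d e g : V}
    (h : Hexa P f a b c d e g) : Hexa P f b a g e d c := by
  obtain ⟨h1, h2, h3⟩ := h
  refine ⟨h1, ?_, ?_⟩
  · rw [h2, Sym2.eq_swap (a := b) (b := a), Sym2.eq_swap (a := a) (b := g),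
      Sym2.eq_swap (a := g) (b := e), Sym2.eq_swap (a := e) (b := d),
      Sym2.eq_swap (a := d) (b := c), Sym2.eq_swap (a := c) (b := b)]
    ext e'; simp only [Finset.mem_insert, Finset.mem_singleton]; tauto
  · simp only [List.nodup_cons, List.mem_cons, List.not_mem_nil, not_or] at h3 ⊢
    grind

theorem exists_pent (P : PlaneGraph V) {f : Finset (Sym2 V)} (hf : f ∈ P.faces)
    (h5 : f.card = 5) : ∃ a b c d e, Pent P f a b c d e := by
  obtain ⟨v, w, hc, he⟩ := P.face_cycle f hf
  have hl : w.length = 5 := by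
    rw [← h5, ← he, List.toFinset_card_of_nodup hc.edges_nodup, SimpleGraph.Walk.length_edges]
  have hn := hc.support_nodup
  match w, hl with
  | .cons (v := b) h1 (.cons (v := c) h2 (.cons (v := d) h3 (.cons (v := e) h4 (.cons h5 .nil)))), _ =>
    refine ⟨v, b, c, d, e, hf, he.symm.trans ?_, ?_⟩
    · ext e'
      simp only [SimpleGraph.Walk.edges_cons, SimpleGraph.Walk.edges_nil, List.mem_toFinset,
        List.mem_cons, List.not_mem_nil, or_false, Finset.mem_insert, Finset.mem_singleton]
    · simp only [SimpleGraph.Walk.support_cons, SimpleGraph.Walk.support_nil, List.tail_cons,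
        List.nodup_cons, List.mem_cons, List.not_mem_nil, not_or] at hn ⊢
      grind

theorem exists_hexa (P : PlaneGraph V) {f : Finset (Sym2 V)} (hf : f ∈ P.faces)
    (h5 : f.card = 6) : ∃ a b c d e g, Hexa P f a b c d e g := by
  obtain ⟨v, w, hc, he⟩ := P.face_cycle f hf
  have hl : w.length = 6 := by
    rw [← h5, ← he, List.toFinset_card_of_nodup hc.edges_nodup, SimpleGraph.Walk.length_edges]
  have hn := hc.support_nodup
  match w, hl with
  | .cons (v := b) h1 (.cons (v := c) h2 (.cons (v := d) h3 (.cons (v := e) h4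
      (.cons (v := g) h5 (.cons h6 .nil))))), _ =>
    refine ⟨v, b, c, d, e, g, hf, he.symm.trans ?_, ?_⟩
    · ext e'
      simp only [SimpleGraph.Walk.edges_cons, SimpleGraph.Walk.edges_nil, List.mem_toFinset,
        List.mem_cons, List.not_mem_nil, or_false, Finset.mem_insert, Finset.mem_singleton]
    · simp only [SimpleGraph.Walk.support_cons, SimpleGraph.Walk.support_nil, List.tail_cons,
        List.nodup_cons, List.mem_cons, List.not_mem_nil, not_or] at hn ⊢
      grind

theorem Pent.cn {P : PlaneGraph V} {f : Finset (Sym2 V)} {a b c d e : V} (h : Pent P f a b c d e) :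
    Cn P f a b c ∧ Cn P f b c d ∧ Cn P f c d e ∧ Cn P f d e a ∧ Cn P f e a b := by
  obtain ⟨h1, rfl, h3⟩ := h
  simp only [List.nodup_cons, List.mem_cons, List.not_mem_nil, not_or] at h3
  refine ⟨⟨h1, ?_, ?_, ?_⟩, ⟨h1, ?_, ?_, ?_⟩, ⟨h1, ?_, ?_, ?_⟩, ⟨h1, ?_, ?_, ?_⟩, ⟨h1, ?_, ?_, ?_⟩⟩
  all_goals first | (simp; done) | grind

theorem Hexa.cn {P : PlaneGraph V} {f : Finset (Sym2 V)} {a b c d e g : V}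
    (h : Hexa P f a b c d e g) :
    Cn P f a b c ∧ Cn P f b c d ∧ Cn P f c d e ∧ Cn P f d e g ∧ Cn P f e g a ∧ Cn P f g a b := by
  obtain ⟨h1, rfl, h3⟩ := h
  simp only [List.nodup_cons, List.mem_cons, List.not_mem_nil, not_or] at h3
  refine ⟨⟨h1, ?_, ?_, ?_⟩, ⟨h1, ?_, ?_, ?_⟩, ⟨h1, ?_, ?_, ?_⟩, ⟨h1, ?_, ?_, ?_⟩, ⟨h1, ?_, ?_, ?_⟩,
    ⟨h1, ?_, ?_, ?_⟩⟩
  all_goals first | (simp; done) | grind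

theorem Cn.det' {P : PlaneGraph V} {f : Finset (Sym2 V)} {x y z w : V} (h : Cn P f x y z)
    (h' : Cn P f x y w) : w = z := by
  rcases h.det h'.2.2.1 with e | e
  · exact absurd e.symm h'.2.2.2
  · exact e

theorem pent_of_edge (P : PlaneGraph V) {f : Finset (Sym2 V)} (hf : f ∈ P.faces)
    (h5 : f.card = 5) {x y : V} (h : s(x, y) ∈ f) : ∃ c d e, Pent P f x y c d e := by
  obtain ⟨a, b, c, d, e, hp⟩ := exists_pent P hf h5
  have h' := h
  rw [hp.2.1] at h'
  simp only [Finset.mem_insert, Finset.mem_singleton, Sym2.eq_iff] at h'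
  rcases h' with (⟨rfl, rfl⟩ | ⟨rfl, rfl⟩) | (⟨rfl, rfl⟩ | ⟨rfl, rfl⟩) | (⟨rfl, rfl⟩ | ⟨rfl, rfl⟩) |
    (⟨rfl, rfl⟩ | ⟨rfl, rfl⟩) | (⟨rfl, rfl⟩ | ⟨rfl, rfl⟩)
  · exact ⟨_, _, _, hp⟩
  · exact ⟨_, _, _, hp.flip⟩
  · exact ⟨_, _, _, hp.rot⟩
  · exact ⟨_, _, _, hp.rot.flip⟩
  · exact ⟨_, _, _, hp.rot.rot⟩
  · exact ⟨_, _, _, hp.rot.rot.flip⟩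
  · exact ⟨_, _, _, hp.rot.rot.rot⟩
  · exact ⟨_, _, _, hp.rot.rot.rot.flip⟩
  · exact ⟨_, _, _, hp.rot.rot.rot.rot⟩
  · exact ⟨_, _, _, hp.rot.rot.rot.rot.flip⟩

theorem hexa_of_edge (P : PlaneGraph V) {f : Finset (Sym2 V)} (hf : f ∈ P.faces)
    (h5 : f.card = 6) {x y : V} (h : s(x, y) ∈ f) : ∃ c d e g, Hexa P f x y c d e g := by
  obtain ⟨a, b, c, d, e, g, hp⟩ := exists_hexa P hf h5
  have h' := h
  rw [hp.2.1] at h'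
  simp only [Finset.mem_insert, Finset.mem_singleton, Sym2.eq_iff] at h'
  rcases h' with (⟨rfl, rfl⟩ | ⟨rfl, rfl⟩) | (⟨rfl, rfl⟩ | ⟨rfl, rfl⟩) | (⟨rfl, rfl⟩ | ⟨rfl, rfl⟩) |
    (⟨rfl, rfl⟩ | ⟨rfl, rfl⟩) | (⟨rfl, rfl⟩ | ⟨rfl, rfl⟩) | (⟨rfl, rfl⟩ | ⟨rfl, rfl⟩)
  · exact ⟨_, _, _, _, hp⟩
  · exact ⟨_, _, _, _, hp.flip⟩
  · exact ⟨_, _, _, _, hp.rot⟩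
  · exact ⟨_, _, _, _, hp.rot.flip⟩
  · exact ⟨_, _, _, _, hp.rot.rot⟩
  · exact ⟨_, _, _, _, hp.rot.rot.flip⟩
  · exact ⟨_, _, _, _, hp.rot.rot.rot⟩
  · exact ⟨_, _, _, _, hp.rot.rot.rot.flip⟩
  · exact ⟨_, _, _, _, hp.rot.rot.rot.rot⟩
  · exact ⟨_, _, _, _, hp.rot.rot.rot.rot.flip⟩
  · exact ⟨_, _, _, _, hp.rot.rot.rot.rot.rot⟩
  · exact ⟨_, _, _, _, hp.rot.rot.rot.rot.rot.flip⟩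

theorem pent_of_cn {P : PlaneGraph V} {f : Finset (Sym2 V)} (h5 : f.card = 5) {x y z : V}
    (h : Cn P f x y z) : ∃ d e, Pent P f x y z d e := by
  obtain ⟨c, d, e, hp⟩ := pent_of_edge P h.1 h5 h.2.1
  have := hp.cn.1.det' h
  subst this
  exact ⟨d, e, hp⟩

/-- A chain of corners through six vertices determines a hexagon. -/
theorem hexa_of_chain {P : PlaneGraph V} {f : Finset (Sym2 V)} (h5 : f.card = 6)
    {x1 x2 x3 x4 x5 x6 : V} (h1 : Cn P f x1 x2 x3) (h2 : Cn P f x2 x3 x4) (h3 : Cn P f x3 x4 x5)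
    (h4 : Cn P f x4 x5 x6) : Hexa P f x1 x2 x3 x4 x5 x6 := by
  obtain ⟨c, d, e, g, hp⟩ := hexa_of_edge P h1.1 h5 h1.2.1
  have := hp.cn.1.det' h1
  subst this
  have := hp.cn.2.1.det' h2
  subst this
  have := hp.cn.2.2.1.det' h3
  subst this
  have := hp.cn.2.2.2.1.det' h4
  subst this
  exact hp

theorem pent_of_chain {P : PlaneGraph V} {f : Finset (Sym2 V)} (h5 : f.card = 5)
    {x1 x2 x3 x4 x5 : V} (h1 : Cn P f x1 x2 x3) (h2 : Cn P f x2 x3 x4) (h3 : Cn P f x3 x4 x5) :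
    Pent P f x1 x2 x3 x4 x5 := by
  obtain ⟨d, e, hp⟩ := pent_of_cn h5 h1
  have := hp.cn.2.1.det' h2
  subst this
  have := hp.cn.2.2.1.det' h3
  subst this
  exact hp

/-- In a fullerene, a chain of corners through six vertices of a face either closes up to a
pentagon or to a hexagon. -/
theorem chain_six {P : PlaneGraph V} (hP : IsFullerene P) {f : Finset (Sym2 V)}
    {x1 x2 x3 x4 x5 x6 : V} (h1 : Cn P f x1 x2 x3) (h2 : Cn P f x2 x3 x4) (h3 : Cn P f x3 x4 x5)
    (h4 : Cn P f x4 x5 x6) :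
    (x6 = x1 ∧ Pent P f x1 x2 x3 x4 x5) ∨ Hexa P f x1 x2 x3 x4 x5 x6 := by
  rcases hP.faceSize f h1.1 with h | h
  · left
    have hp := pent_of_chain h h1 h2 h3
    exact ⟨hp.cn.2.2.2.1.symm.symm.det' h4 , hp⟩
  · exact Or.inr (hexa_of_chain h h1 h2 h3 h4)

/-! ### Connectivity -/

theorem face_nonempty (P : PlaneGraph V) {f : Finset (Sym2 V)} (hf : f ∈ P.faces) :
    ∃ x y, s(x, y) ∈ f := by
  obtain ⟨v, c, hc, he⟩ := P.face_cycle f hf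
  match c, hc, he with
  | .nil, hc, _ => exact absurd rfl hc.ne_nil
  | .cons (v := b) h p, _, he => exact ⟨v, b, by rw [← he]; simp⟩

theorem sw {f : Finset (Sym2 V)} {x y : V} (h : s(x, y) ∈ f) : s(y, x) ∈ f := by
  rw [Sym2.eq_swap]; exact h

/-- Two faces sharing a vertex share an edge at this vertex. -/
theorem share (P : PlaneGraph V) (hP : IsFullerene P) {f g : Finset (Sym2 V)} (hf : f ∈ P.faces)
    (hg : g ∈ P.faces) {x y z : V} (h1 : s(x, y) ∈ f) (h2 : s(x, z) ∈ g) :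
    ∃ w, s(x, w) ∈ f ∧ s(x, w) ∈ g := by
  obtain ⟨y', hy⟩ := Cn.ext P hf (sw h1)
  obtain ⟨z', hz⟩ := Cn.ext P hg (sw h2)
  by_cases e1 : z = y
  · subst e1; exact ⟨z, h1, h2⟩
  by_cases e2 : z = y'
  · subst e2; exact ⟨z, hy.2.2.1, h2⟩
  rcases nbrs P hP hy.2.2.2 (Ne.symm e1) (Ne.symm e2) hy.adj.1 hy.adj.2 hz.adj.1 hz.adj.2
    with h | h | h
  · subst h; exact ⟨z', h1, hz.2.2.1⟩
  · subst h; exact ⟨z', hy.2.2.1, hz.2.2.1⟩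
  · exact absurd h.symm hz.2.2.2

theorem reach (P : PlaneGraph V) (hP : IsFullerene P) (x y : V) : P.graph.Reachable x y := by
  have h := (hP.threeConnected ∅ (by simp)).preconnected ⟨x, by simp⟩ ⟨y, by simp⟩
  exact h.map (SimpleGraph.Embedding.induce _).toHom

theorem closed_all (P : PlaneGraph V) (hP : IsFullerene P) (S : Finset (Sym2 V) → Prop)
    {f0 : Finset (Sym2 V)} (hf0 : f0 ∈ P.faces) (h0 : S f0)
    (hS : ∀ f ∈ P.faces, S f → ∀ g ∈ P.faces, ∀ x y, s(x, y) ∈ f → s(x, y) ∈ g → S g) :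
    ∀ g ∈ P.faces, S g := by
  have step : ∀ x y, P.graph.Adj x y → (∃ f ∈ P.faces, S f ∧ ∃ w, s(x, w) ∈ f) →
      (∃ f ∈ P.faces, S f ∧ ∃ w, s(y, w) ∈ f) := by
    rintro x y hxy ⟨f, hf, hSf, w, hw⟩
    obtain ⟨g, g', hgg, hg, hg', he, -⟩ := edge_two P hxy
    obtain ⟨z, hz1, hz2⟩ := share P hP hf hg hw he
    exact ⟨g, hg, hS f hf hSf g hg x z hz1 hz2, x, sw he⟩
  have walk : ∀ x y (c : P.graph.Walk x y), (∃ f ∈ P.faces, S f ∧ ∃ w, s(x, w) ∈ f) →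
      (∃ f ∈ P.faces, S f ∧ ∃ w, s(y, w) ∈ f) := by
    intro x y c
    induction c with
    | nil => exact id
    | cons h p ih => exact fun hx => ih (step _ _ h hx)
  intro g hg
  obtain ⟨x, y, hxy⟩ := face_nonempty P hg
  obtain ⟨x0, y0, hxy0⟩ := face_nonempty P hf0
  obtain ⟨c⟩ := reach P hP x0 x
  obtain ⟨f, hf, hSf, w, hw⟩ := walk x0 x c ⟨f0, hf0, h0, y0, hxy0⟩
  obtain ⟨z, hz1, hz2⟩ := share P hP hf hg hw hxy
  exact hS f hf hSf g hg x z hz1 hz2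

theorem walk_const {G : SimpleGraph V} (W : V → Prop) {a b : V} (c : G.Walk a b)
    (h : ∀ x y, s(x, y) ∈ c.edges → W x → W y) : ∀ x ∈ c.support, (W x ↔ W a) := by
  induction c with
  | nil => intro x hx; simp at hx; rw [hx]
  | cons hadj p ih =>
    rename_i u v w
    intro x hx
    have h1 : W u → W v := h u v (by simp)
    have h2 : W v → W u := h v u (by simp [Sym2.eq_swap])
    rw [SimpleGraph.Walk.support_cons, List.mem_cons] at hx
    rcases hx with rfl | hx
    · rfl
    · rw [ih (fun x y hxy => h x y (by simp [hxy])) x hx]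
      exact ⟨h2, h1⟩

theorem mem_fragEdges {P : PlaneGraph V} {A : Fragment P} {e : Sym2 V} :
    e ∈ A.edges ↔ ∃ f ∈ A.inFaces, e ∈ f := by
  simp [Fragment.edges, Finset.mem_sup]

/-- The boundary of a fragment is connected. -/
theorem boundary_const {P : PlaneGraph V} (A : Fragment P) (W : V → Prop)
    (h : ∀ x y, ∀ f ∈ A.inFaces, s(x, y) ∈ f → (∀ g ∈ A.inFaces, s(x, y) ∈ g → g = f) →
      W x → W y) :
    ∀ x y, ∀ f ∈ A.inFaces, s(x, y) ∈ f → (∀ g ∈ A.inFaces, s(x, y) ∈ g → g = f) →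
    ∀ x' y', ∀ f' ∈ A.inFaces, s(x', y') ∈ f' → (∀ g ∈ A.inFaces, s(x', y') ∈ g → g = f') →
      W x → W x' := by
  obtain ⟨v, c, hc, he⟩ := A.boundary_cycle
  have hm : ∀ e, e ∈ c.edges ↔ ∃ f ∈ A.inFaces, e ∈ f ∧ ∀ g ∈ A.inFaces, e ∈ g → g = f := by
    intro e
    rw [← List.mem_toFinset, he, Finset.mem_filter]
    constructor
    · rintro ⟨h1, h2⟩
      obtain ⟨f, hf⟩ := Finset.card_eq_one.1 h2
      have hm : ∀ k, k ∈ A.inFaces.filter (fun f => e ∈ f) ↔ k = f := by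
        intro k; rw [hf]; simp
      simp only [Finset.mem_filter] at hm
      exact ⟨f, ((hm f).2 rfl).1, ((hm f).2 rfl).2, fun g hg hg' => (hm g).1 ⟨hg, hg'⟩⟩
    · rintro ⟨f, hf, hef, hu⟩
      refine ⟨mem_fragEdges.2 ⟨f, hf, hef⟩, Finset.card_eq_one.2 ⟨f, ?_⟩⟩
      ext k
      simp only [Finset.mem_filter, Finset.mem_singleton]
      exact ⟨fun hk => hu k hk.1 hk.2, by rintro rfl; exact ⟨hf, hef⟩⟩
  have key := walk_const W c (fun x y hxy => by
    obtain ⟨f, hf, h1, h2⟩ := (hm _).1 hxy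
    exact h x y f hf h1 h2)
  intro x y f hf h1 h2 x' y' f' hf' h1' h2' hx
  have a1 := c.fst_mem_support_of_mem_edges ((hm s(x, y)).2 ⟨f, hf, h1, h2⟩)
  have a2 := c.fst_mem_support_of_mem_edges ((hm s(x', y')).2 ⟨f', hf', h1', h2'⟩)
  exact (key x' a2).2 ((key x a1).1 hx)

theorem frag_conn {P : PlaneGraph V} (hP : IsFullerene P) (A : Fragment P)
    (S : Finset (Sym2 V) → Prop) {f0 : Finset (Sym2 V)} {u v : V}
    (hf0 : f0 ∈ A.inFaces) (h0 : S f0) (huv : s(u, v) ∈ f0)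
    (hb : ∀ g ∈ A.inFaces, s(u, v) ∈ g → g = f0)
    (hS : ∀ f ∈ A.inFaces, S f → ∀ g ∈ A.inFaces, ∀ x y, s(x, y) ∈ f → s(x, y) ∈ g → S g) :
    ∀ g ∈ A.inFaces, S g := by
  have hsub := fun f (hf : f ∈ A.inFaces) => A.subFaces hf
  have hW := boundary_const A (fun x => ∃ f ∈ A.inFaces, S f ∧ ∃ w, s(x, w) ∈ f) (by
    rintro x y f hf hxy - ⟨k, hk, hSk, w, hw⟩
    obtain ⟨z, hz1, hz2⟩ := share P hP (hsub k hk) (hsub f hf) hw hxy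
    exact ⟨f, hf, hS k hk hSk f hf x z hz1 hz2, x, sw hxy⟩)
  intro g hg
  by_contra hng
  have := closed_all P hP (fun k => k ∈ A.inFaces ∧ ¬ S k) (hsub g hg) ⟨hg, hng⟩ (by
    rintro f hf ⟨hfA, hfS⟩ k hk x y hxf hxk
    by_cases hkA : k ∈ A.inFaces
    · exact ⟨hkA, fun hSk => hfS (hS k hkA hSk f hfA x y hxk hxf)⟩
    · exfalso
      have hbd : ∀ g ∈ A.inFaces, s(x, y) ∈ g → g = f := by
        intro g' hg' hxg'
        obtain ⟨g1, -, -, -, hall⟩ := other_face P hk hxk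
        have e1 := hall f hf hxf
        have e2 := hall g' (hsub g' hg') hxg'
        have e3 : f ≠ k := by rintro rfl; exact hkA hfA
        have e4 : g' ≠ k := by rintro rfl; exact hkA hg'
        grind
      obtain ⟨k', hk', hSk', w, hw⟩ := hW u v f0 hf0 huv hb x y f hfA hxf hbd ⟨f0, hf0, h0, v, huv⟩
      obtain ⟨z, hz1, hz2⟩ := share P hP (hsub k' hk') hf hw hxf
      exact hfS (hS k' hk' hSk' f hfA x z hz1 hz2))
  exact (this f0 (hsub f0 hf0)).2 h0

theorem pentFaces_eq {P : PlaneGraph V} (hP : IsFullerene P) (A : Fragment P)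
    (h5 : IsPentagonalFragment A) (hc : A.inFaces.card ≤ 10) : pentFaces P A.edges = A.inFaces := by
  have hsub := fun f (hf : f ∈ A.inFaces) => A.subFaces hf
  ext p
  simp only [pentFaces, Finset.mem_filter]
  constructor
  swap
  · intro hp
    exact ⟨hsub p hp, h5 p hp, fun e he => mem_fragEdges.2 ⟨p, hp, he⟩⟩
  rintro ⟨hp, hp5, hpE⟩
  by_contra hpA
  -- every edge of `p` is a boundary edge
  have hbd : ∀ x y, s(x, y) ∈ p → ∃ f ∈ A.inFaces, s(x, y) ∈ f ∧
      ∀ g ∈ A.inFaces, s(x, y) ∈ g → g = f := by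
    intro x y hxy
    obtain ⟨f, hf, hxf⟩ := mem_fragEdges.1 (hpE hxy)
    obtain ⟨g1, -, -, -, hall⟩ := other_face P hp hxy
    refine ⟨f, hf, hxf, fun g hg hxg => ?_⟩
    have e1 := hall f (hsub f hf) hxf
    have e2 := hall g (hsub g hg) hxg
    have e3 : f ≠ p := by rintro rfl; exact hpA hf
    have e4 : g ≠ p := by rintro rfl; exact hpA hg
    grind
  have hin : ∀ x y, ∀ f ∈ A.inFaces, s(x, y) ∈ f → (∀ g ∈ A.inFaces, s(x, y) ∈ g → g = f) →
      (∃ w, s(x, w) ∈ p) → s(x, y) ∈ p := by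
    rintro x y f hf hxf hu ⟨w, hw⟩
    by_contra hyp
    obtain ⟨w', hcn⟩ := Cn.ext P hp (sw hw)
    have hyw : y ≠ w := by rintro rfl; exact hyp hw
    have hyw' : y ≠ w' := by rintro rfl; exact hyp hcn.2.2.1
    have hadj : P.graph.Adj x y := by simpa using P.face_edges f (hsub f hf) _ hxf
    obtain ⟨k1, hk1, hxk1, -⟩ := hbd x w hw
    obtain ⟨k2, hk2, hxk2, -⟩ := hbd x w' hcn.2.2.1
    have hne1 : k1 ≠ p := by rintro rfl; exact hpA hk1
    have hne2 : k2 ≠ p := by rintro rfl; exact hpA hk2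
    have c1 := hcn.symm.other hP hadj hyw' hyw (hsub k1 hk1) hxk1 hne1
    have c2 := hcn.other hP hadj hyw hyw' (hsub k2 hk2) hxk2 hne2
    have e1 := hu k1 hk1 c1.2.2.1
    have e2 := hu k2 hk2 c2.2.2.1
    have e3 : k1 = k2 := e1.trans e2.symm
    subst e3
    rcases c1.det hxk2 with h | h
    · exact hcn.2.2.2 h.symm
    · exact hyw' h.symm
  obtain ⟨x0, y0, hxy0⟩ := face_nonempty P hp
  obtain ⟨f0, hf0, hxf0, hu0⟩ := hbd x0 y0 hxy0
  have hW := boundary_const A (fun x => ∃ w, s(x, w) ∈ p) (fun x y f hf hxf hu hw =>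
    ⟨x, sw (hin x y f hf hxf hu hw)⟩) x0 y0 f0 hf0 hxf0 hu0
  have hall := closed_all P hP (fun k => k ∈ A.inFaces ∨ k = p) hp (Or.inr rfl) (by
    rintro f hf hfS k hk x y hxf hxk
    by_contra hcon
    push Not at hcon
    obtain ⟨hkA, hkp⟩ := hcon
    obtain ⟨g1, -, -, -, hall⟩ := other_face P hk hxk
    rcases hfS with hfA | rfl
    · have hu : ∀ g ∈ A.inFaces, s(x, y) ∈ g → g = f := by
        intro g hg hxg
        have e1 := hall f hf hxf
        have e2 := hall g (hsub g hg) hxg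
        have e3 : f ≠ k := by rintro rfl; exact hkA hfA
        have e4 : g ≠ k := by rintro rfl; exact hkA hg
        grind
      have hxp := hin x y f hfA hxf hu (hW x y f hfA hxf hu ⟨y0, hxy0⟩)
      have e1 := hall f hf hxf
      have e2 := hall p hp hxp
      have e3 : f ≠ k := by rintro rfl; exact hkA hfA
      have e4 : p ≠ f := by rintro rfl; exact hpA hfA
      grind
    · obtain ⟨g, hg, hxg, -⟩ := hbd x y hxf
      have e1 := hall f hf hxf
      have e2 := hall g (hsub g hg) hxg
      have e3 : g ≠ k := by rintro rfl; exact hkA hg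
      have e4 : g ≠ f := by rintro rfl; exact hpA hg
      grind)
  have hle : P.faces.filter (fun f => f.card = 5) ⊆ insert p A.inFaces := by
    intro k hk
    rw [Finset.mem_filter] at hk
    rcases hall k hk.1 with h | h
    · exact Finset.mem_insert_of_mem h
    · rw [h]; exact Finset.mem_insert_self _ _
  have := Finset.card_le_card hle
  rw [hP.pentTwelve] at this
  have := Finset.card_insert_le p A.inFaces
  omega

/-! ### Exits -/

/-- A vertex covered by the hexagons. -/
def OnH (H : Finset (Finset (Sym2 V))) (x : V) : Prop := ∃ h ∈ H, ∃ w, s(x, w) ∈ h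

/-- An edge of a hexagon or of the matching. -/
def TT (H : Finset (Finset (Sym2 V))) (M : Finset (Sym2 V)) (x y : V) : Prop :=
  (∃ h ∈ H, s(x, y) ∈ h) ∨ s(x, y) ∈ M

/-- Extracted data of an extremal fragment. -/
structure Sys (P : PlaneGraph V) (Q H : Finset (Finset (Sym2 V))) (M : Finset (Sym2 V)) :
    Prop where
  hP : IsFullerene P
  Qf : ∀ q ∈ Q, q ∈ P.faces
  Q5 : ∀ q ∈ Q, q.card = 5
  Hf : ∀ h ∈ H, h ∈ P.faces
  H6 : ∀ h ∈ H, h.card = 6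
  Hd : ∀ h ∈ H, ∀ h' ∈ H, ∀ x y z, s(x, y) ∈ h → s(x, z) ∈ h' → h = h'
  Mq : ∀ x y, s(x, y) ∈ M → ∃ q ∈ Q, s(x, y) ∈ q
  Mm : ∀ x y z, s(x, y) ∈ M → s(x, z) ∈ M → y = z
  MH : ∀ x y, s(x, y) ∈ M → ¬ OnH H x
  cov : ∀ x, (∀ w, P.graph.Adj x w → ∃ q ∈ Q, s(x, w) ∈ q) → ¬ OnH H x → ∃ y, s(x, y) ∈ M
  Ucard : ∀ s : Finset V, (∀ x ∈ s, ¬ OnH H x ∧ ∃ q ∈ Q, ∃ w, s(x, w) ∈ q) → s.card ≤ Q.card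

theorem mem_facesVerts {H : Finset (Finset (Sym2 V))} {x : V} : x ∈ facesVerts H ↔ OnH H x := by
  simp only [facesVerts, edgeVerts, OnH, Finset.mem_filter, Finset.mem_univ, true_and,
    Finset.mem_sup, id]
  constructor
  · rintro ⟨e, ⟨h, hh, he⟩, hx⟩
    obtain ⟨w, rfl⟩ := Sym2.mem_iff_exists.1 hx
    exact ⟨h, hh, w, he⟩
  · rintro ⟨h, hh, w, hw⟩
    exact ⟨_, ⟨h, hh, hw⟩, Sym2.mem_mk_left _ _⟩

theorem mem_edgeVerts {E : Finset (Sym2 V)} {x : V} : x ∈ edgeVerts E ↔ ∃ w, s(x, w) ∈ E := by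
  simp only [edgeVerts, Finset.mem_filter, Finset.mem_univ, true_and]
  constructor
  · rintro ⟨e, he, hx⟩
    obtain ⟨w, rfl⟩ := Sym2.mem_iff_exists.1 hx
    exact ⟨w, he⟩
  · rintro ⟨w, hw⟩
    exact ⟨_, hw, Sym2.mem_mk_left _ _⟩

theorem sys_of {P : PlaneGraph V} (hP : IsFullerene P) (A : Fragment P)
    (h5 : IsPentagonalFragment A) (hc : A.inFaces.card ≤ 10) (hex : IsExtremalSub P A.edges)
    {H : Finset (Finset (Sym2 V))} (hH : IsClarSet P A.edges H) :
    ∃ M, Sys P A.inFaces H M := by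
  obtain ⟨H0, hH0, hcard⟩ := hex
  rw [pentFaces_eq hP A h5 hc] at hcard
  have hU : (Uset A.edges H).card = A.inFaces.card := by
    rw [← hcard]
    exact le_antisymm (hH.2 H0 hH0.1) (hH0.2 H hH.1)
  obtain ⟨⟨hf, hd, M, hME, hMm, hMH, hcov⟩, -⟩ := hH
  refine ⟨M, ⟨hP, fun q hq => A.subFaces hq, h5, fun h hh => (hf h hh).1, fun h hh => (hf h hh).2.1,
    ?_, ?_, ?_, ?_, ?_, ?_⟩⟩
  · intro h hh h' hh' x y z hy hz
    by_contra hne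
    exact Finset.disjoint_left.1 (hd h hh h' hh' hne) (mem_edgeVerts.2 ⟨y, hy⟩)
      (mem_edgeVerts.2 ⟨z, hz⟩)
  · intro x y hxy
    exact mem_fragEdges.1 (hME hxy)
  · intro x y z hy hz
    by_contra hne
    exact hMm.2 _ hy _ hz (fun h => hne (Sym2.congr_right.1 h)) x (Sym2.mem_mk_left _ _)
      (Sym2.mem_mk_left _ _)
  · intro x y hxy hx
    exact hMH _ hxy x (Sym2.mem_mk_left _ _) (mem_facesVerts.2 hx)
  · intro x hx hxH
    obtain ⟨a, b, c, hab, hac, hbc, hs⟩ := Set.ncard_eq_three.1 (hP.cubic x)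
    have hm : ∀ k, P.graph.Adj x k ↔ k = a ∨ k = b ∨ k = c := by
      intro k
      have : k ∈ P.graph.neighborSet x ↔ k ∈ ({a, b, c} : Set V) := by rw [hs]
      simpa using this
    have hE : ∀ w, P.graph.Adj x w ↔ s(x, w) ∈ A.edges := by
      intro w
      constructor
      · intro h
        exact mem_fragEdges.2 (hx w h)
      · intro h
        obtain ⟨f, hf, hxf⟩ := mem_fragEdges.1 h
        simpa using P.face_edges f (A.subFaces hf) _ hxf
    have hdeg : deg A.edges x = 3 := by
      have : A.edges.filter (fun e => x ∈ e) = {s(x, a), s(x, b), s(x, c)} := by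
        ext e
        simp only [Finset.mem_filter, Finset.mem_insert, Finset.mem_singleton]
        constructor
        · rintro ⟨h1, h2⟩
          obtain ⟨w, rfl⟩ := Sym2.mem_iff_exists.1 h2
          rcases (hm w).1 ((hE w).2 h1) with rfl | rfl | rfl <;> simp
        · rintro (rfl | rfl | rfl)
          · exact ⟨(hE a).1 ((hm a).2 (by simp)), by simp⟩
          · exact ⟨(hE b).1 ((hm b).2 (by simp)), by simp⟩
          · exact ⟨(hE c).1 ((hm c).2 (by simp)), by simp⟩
      rw [deg, this]
      exact Finset.card_eq_three.2 ⟨_, _, _, fun h => hab (Sym2.congr_right.1 h),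
        fun h => hac (Sym2.congr_right.1 h), fun h => hbc (Sym2.congr_right.1 h), rfl⟩
    obtain ⟨e, he, hxe⟩ := hcov x (mem_edgeVerts.2 ⟨a, (hE a).1 ((hm a).2 (by simp))⟩) hdeg
      (fun h => hxH (mem_facesVerts.1 h))
    obtain ⟨w, rfl⟩ := Sym2.mem_iff_exists.1 hxe
    exact ⟨w, he⟩
  · intro s hs
    rw [← hU]
    apply Finset.card_le_card
    intro x hx
    obtain ⟨h1, q, hq, w, hw⟩ := hs x hx
    rw [Uset, Finset.mem_sdiff]
    exact ⟨mem_edgeVerts.2 ⟨w, mem_fragEdges.2 ⟨q, hq, hw⟩⟩, fun h => h1 (mem_facesVerts.1 h)⟩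

/-- An exit of a pentagon. -/
def Exit (P : PlaneGraph V) (Q H : Finset (Finset (Sym2 V))) (M : Finset (Sym2 V))
    (p : Finset (Sym2 V)) (x : V) : Prop :=
  p ∈ Q ∧ ∃ y z, Cn P p y x z ∧ ¬ TT H M x y ∧ ¬ TT H M x z

section
variable {P : PlaneGraph V} {Q H : Finset (Finset (Sym2 V))} {M : Finset (Sym2 V)}

theorem TT.symm {x y : V} (h : TT H M x y) : TT H M y x := by
  rcases h with ⟨h, hh, hx⟩ | h
  · exact Or.inl ⟨h, hh, sw hx⟩
  · exact Or.inr (sw h)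

theorem Sys.hneq (S : Sys P Q H M) {p h : Finset (Sym2 V)} (hp : p ∈ Q) (hh : h ∈ H) : p ≠ h := by
  rintro rfl
  have := S.Q5 p hp
  have := S.H6 p hh
  omega

theorem Sys.exit_notH (S : Sys P Q H M) {p : Finset (Sym2 V)} {x : V} (h : Exit P Q H M p x) :
    ¬ OnH H x := by
  rintro ⟨k, hk, w, hw⟩
  obtain ⟨hp, y, z, hcn, hy, hz⟩ := h
  obtain ⟨t, ht1, ht2⟩ := share P S.hP (S.Qf p hp) (S.Hf k hk) hcn.2.2.1 hw
  rcases hcn.det ht1 with rfl | rfl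
  · exact hy (Or.inl ⟨k, hk, ht2⟩)
  · exact hz (Or.inl ⟨k, hk, ht2⟩)

theorem Sys.tt_match (S : Sys P Q H M) {p : Finset (Sym2 V)} (hp : p ∈ Q) {x y z : V}
    (hcn : Cn P p y x z) (hy : TT H M x y) (hz : TT H M x z) : False := by
  rcases hy with ⟨h, hh, hx⟩ | hy <;> rcases hz with ⟨h', hh', hx'⟩ | hz
  · have := S.Hd h hh h' hh' x y z hx hx'
    subst this
    have : Cn P h y x z := ⟨S.Hf h hh, sw hx, hx', hcn.2.2.2⟩
    exact S.hneq hp hh (hcn.uniq S.hP this)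
  · exact S.MH x z hz ⟨h, hh, y, hx⟩
  · exact S.MH x y hy ⟨h', hh', z, hx'⟩
  · exact hcn.2.2.2 (S.Mm x y z hy hz)

theorem Sys.exit_exists (S : Sys P Q H M) {p : Finset (Sym2 V)} (hp : p ∈ Q) :
    ∃ x, Exit P Q H M p x := by
  obtain ⟨a, b, c, d, e, hpent⟩ := exists_pent P (S.Qf p hp) (S.Q5 p hp)
  obtain ⟨c1, c2, c3, c4, c5⟩ := hpent.cn
  by_contra hno
  push Not at hno
  have key : ∀ x y z, Cn P p y x z → (TT H M y x ↔ ¬ TT H M x z) := by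
    intro x y z hcn
    constructor
    · intro h1 h2
      exact S.tt_match hp hcn h1.symm h2
    · intro h1
      by_contra h2
      exact hno x ⟨hp, y, z, hcn, fun h => h2 h.symm, h1⟩
  have k1 := key _ _ _ c1
  have k2 := key _ _ _ c2
  have k3 := key _ _ _ c3
  have k4 := key _ _ _ c4
  have k5 := key _ _ _ c5
  tauto

theorem Sys.exit_inj (S : Sys P Q H M) {p q : Finset (Sym2 V)} {x : V} (h : Exit P Q H M p x)
    (h' : Exit P Q H M q x) : p = q := by
  by_contra hne
  have hx := S.exit_notH h
  obtain ⟨hp, y, z, hcn, hy, hz⟩ := h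
  obtain ⟨hq, y', z', hcn', hy', hz'⟩ := h'
  have hall : ∀ w, P.graph.Adj x w → (w = y ∨ w = z ∨ w = y' ∨ w = z') := by
    intro w hw
    by_contra hcon
    push Not at hcon
    obtain ⟨e1, e2, e3, e4⟩ := hcon
    have n1 := nbrs P S.hP hcn.2.2.2 e1.symm e2.symm hcn.adj.1 hcn.adj.2 hw hcn'.adj.1
    have n2 := nbrs P S.hP hcn.2.2.2 e1.symm e2.symm hcn.adj.1 hcn.adj.2 hw hcn'.adj.2
    have := hcn'.2.2.2
    have : (y' = y ∧ z' = z) ∨ (y' = z ∧ z' = y) := by grind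
    rcases this with ⟨rfl, rfl⟩ | ⟨rfl, rfl⟩
    · exact hne (hcn.uniq S.hP hcn')
    · exact hne (hcn.uniq S.hP hcn'.symm)
  obtain ⟨m, hm⟩ := S.cov x (by
    intro w hw
    rcases hall w hw with rfl | rfl | rfl | rfl
    · exact ⟨p, hp, sw hcn.2.1⟩
    · exact ⟨p, hp, hcn.2.2.1⟩
    · exact ⟨q, hq, sw hcn'.2.1⟩
    · exact ⟨q, hq, hcn'.2.2.1⟩) hx
  obtain ⟨k, hk, hxk⟩ := S.Mq x m hm
  have hadj : P.graph.Adj x m := by simpa using P.face_edges k (S.Qf k hk) _ hxk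
  rcases hall m hadj with rfl | rfl | rfl | rfl
  · exact hy (Or.inr hm)
  · exact hz (Or.inr hm)
  · exact hy' (Or.inr hm)
  · exact hz' (Or.inr hm)

theorem Sys.exit_of (S : Sys P Q H M) {q : Finset (Sym2 V)} {x w : V} (hq : q ∈ Q)
    (hx : s(x, w) ∈ q) (hxH : ¬ OnH H x) : ∃ p, Exit P Q H M p x := by
  haveI : Nonempty V := ⟨x⟩
  choose! g hg using fun p (hp : p ∈ Q) => S.exit_exists hp
  by_contra hcon
  push Not at hcon
  have hinj : Set.InjOn g Q := by
    intro p hp p' hp' he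
    have h1 := hg p hp
    have h2 := hg p' hp'
    rw [he] at h1
    exact S.exit_inj h1 h2
  have hx' : x ∉ Q.image g := by
    rw [Finset.mem_image]
    rintro ⟨p, hp, rfl⟩
    exact hcon p (hg p hp)
  have h1 := S.Ucard (insert x (Q.image g)) (by
    intro y hy
    rw [Finset.mem_insert, Finset.mem_image] at hy
    rcases hy with rfl | ⟨p, hp, rfl⟩
    · exact ⟨hxH, q, hq, w, hx⟩
    · have := hg p hp
      refine ⟨S.exit_notH this, ?_⟩
      obtain ⟨-, y, z, hcn, -⟩ := this
      exact ⟨p, hp, z, hcn.2.2.1⟩)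
  rw [Finset.card_insert_of_notMem hx', Finset.card_image_of_injOn hinj] at h1
  omega

theorem Sys.exit_uniq (S : Sys P Q H M) {p : Finset (Sym2 V)} {x x' : V}
    (h : Exit P Q H M p x) (h' : Exit P Q H M p x') : x = x' := by
  haveI : Nonempty V := ⟨x⟩
  choose! g hg using fun p (hp : p ∈ Q) => S.exit_exists hp
  suffices hs : ∀ x, Exit P Q H M p x → x = g p by rw [hs x h, hs x' h']
  clear h h' x x'
  intro x h
  by_contra hne
  have hinj : Set.InjOn g Q := by
    intro p hp p' hp' he
    have h1 := hg p hp
    have h2 := hg p' hp'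
    rw [he] at h1
    exact S.exit_inj h1 h2
  have hx' : x ∉ Q.image g := by
    rw [Finset.mem_image]
    rintro ⟨q, hq, rfl⟩
    have := S.exit_inj h (hg q hq)
    exact hne (by rw [this])
  have h1 := S.Ucard (insert x (Q.image g)) (by
    intro y hy
    rw [Finset.mem_insert, Finset.mem_image] at hy
    rcases hy with rfl | ⟨p, hp, rfl⟩
    · refine ⟨S.exit_notH h, ?_⟩
      obtain ⟨hp, y, z, hcn, -⟩ := h
      exact ⟨p, hp, z, hcn.2.2.1⟩
    · have := hg p hp
      refine ⟨S.exit_notH this, ?_⟩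
      obtain ⟨-, y, z, hcn, -⟩ := this
      exact ⟨p, hp, z, hcn.2.2.1⟩)
  rw [Finset.card_insert_of_notMem hx', Finset.card_image_of_injOn hinj] at h1
  omega

/-- The exit pattern. -/
theorem Sys.pattern (S : Sys P Q H M) {p : Finset (Sym2 V)} {c a v u b : V}
    (h : Exit P Q H M p c) (hp : Pent P p c a v u b) :
    TT H M a v ∧ TT H M u b ∧ ¬ TT H M c a ∧ ¬ TT H M c b ∧ ¬ TT H M v u := by
  have hpQ := h.1
  have hex := h
  obtain ⟨c1, c2, c3, c4, c5⟩ := hp.cn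
  have hnd := hp.2.2
  simp only [List.nodup_cons, List.mem_cons, List.not_mem_nil, not_or] at hnd
  have n1 : a ≠ c := fun h => hnd.1.1 h.symm
  have n2 : v ≠ c := fun h => hnd.1.2.1 h.symm
  have n3 : u ≠ c := fun h => hnd.1.2.2.1 h.symm
  clear hnd
  obtain ⟨-, y, z, hcn, hy, hz⟩ := h
  have hh : ¬ TT H M c a ∧ ¬ TT H M c b := by
    have e1 := hcn.det c5.2.2.1
    have e2 := hcn.det (sw c5.2.1)
    have : a ≠ b := c5.2.2.2.symm
    rcases e1 with rfl | rfl <;> rcases e2 with rfl | rfl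
    · exact absurd rfl this
    · exact ⟨hy, hz⟩
    · exact ⟨hz, hy⟩
    · exact absurd rfl this
  have key : ∀ x y z, x ≠ c → Cn P p y x z → (TT H M y x ↔ ¬ TT H M x z) := by
    intro x y z hxc hcn
    constructor
    · intro h1 h2
      exact S.tt_match hpQ hcn h1.symm h2
    · intro h1
      by_contra h2
      exact hxc (S.exit_uniq ⟨hpQ, y, z, hcn, fun h => h2 h.symm, h1⟩ hex)
  have k1 := key _ _ _ n1 c1
  have k2 := key _ _ _ n2 c2
  have k3 := key _ _ _ n3 c3
  clear key c1 c2 c3 c4 c5 n1 n2 n3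
  have t1 : TT H M a v := by
    by_contra h
    exact hh.1 (k1.2 h)
  have t2 : ¬ TT H M v u := k2.1 t1
  have t3 : TT H M u b := by
    by_contra h
    exact t2 (k3.2 h)
  exact ⟨t1, t3, hh.1, hh.2, t2⟩

theorem Sys.exit_cases (S : Sys P Q H M) {p : Finset (Sym2 V)} {c a v u b : V}
    (hpQ : p ∈ Q) (hp : Pent P p c a v u b) :
    Exit P Q H M p c ∨ Exit P Q H M p a ∨ Exit P Q H M p v ∨ Exit P Q H M p u ∨
      Exit P Q H M p b := by
  obtain ⟨x, hx⟩ := S.exit_exists hpQ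
  have hx' := hx
  obtain ⟨-, y, z, hcn, -, -⟩ := hx'
  have := hcn.2.2.1
  rw [hp.2.1] at this
  simp only [Finset.mem_insert, Finset.mem_singleton, Sym2.eq_iff] at this
  rcases this with (⟨rfl, rfl⟩ | ⟨rfl, rfl⟩) | (⟨rfl, rfl⟩ | ⟨rfl, rfl⟩) | (⟨rfl, rfl⟩ | ⟨rfl, rfl⟩) |
    (⟨rfl, rfl⟩ | ⟨rfl, rfl⟩) | (⟨rfl, rfl⟩ | ⟨rfl, rfl⟩) <;> tauto

/-- A `T`-edge `c d` of a pentagon forces the exit. -/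
theorem Sys.exit_of_tt (S : Sys P Q H M) {p : Finset (Sym2 V)} {c d y r a : V}
    (hpQ : p ∈ Q) (hp : Pent P p c d y r a) (h : TT H M c d) :
    Exit P Q H M p y ∨ Exit P Q H M p a := by
  rcases S.exit_cases hpQ hp with h1 | h1 | h1 | h1 | h1
  · exact absurd h (S.pattern h1 hp).2.2.1
  · exact absurd h.symm (S.pattern h1 hp.rot).2.2.2.1
  · exact Or.inl h1
  · exact absurd h (S.pattern h1 hp.rot.rot.rot).2.2.2.2
  · exact Or.inr h1
  
end

/-! ### The local configurations -/

/-- Properties of the pasting edge. -/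
structure Edg (P : PlaneGraph V) (Q H : Finset (Finset (Sym2 V))) (u v : V) : Prop where
  bd : ∀ f ∈ Q, ∀ g ∈ Q, s(u, v) ∈ f → s(u, v) ∈ g → f = g
  ex : ∃ f ∈ Q, s(u, v) ∈ f
  onu : OnH H u
  onv : OnH H v
  noH : ∀ h ∈ H, s(u, v) ∉ h
  conn : ∀ S : Finset (Sym2 V) → Prop, (∀ f ∈ Q, s(u, v) ∈ f → S f) →
    (∀ f ∈ Q, S f → ∀ g ∈ Q, ∀ x y, s(x, y) ∈ f → s(x, y) ∈ g → S g) → ∀ g ∈ Q, S g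

theorem Edg.symm {P : PlaneGraph V} {Q H : Finset (Finset (Sym2 V))} {u v : V}
    (E : Edg P Q H u v) : Edg P Q H v u := by
  have h : s(v, u) = s(u, v) := Sym2.eq_swap
  obtain ⟨h1, h2, h3, h4, h5, h6⟩ := E
  rw [← h] at h1 h2 h5 h6
  exact ⟨h1, h2, h4, h3, h5, h6⟩

/-- The core configuration. -/
structure Core (P : PlaneGraph V) (Q H : Finset (Finset (Sym2 V))) (M : Finset (Sym2 V))
    (u v : V) : Type where
  (c a b a' y d z t w x1 x2 x3 : V)
  (fA f pd pz h1 h2 h3 : Finset (Sym2 V))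
  PA : Pent P fA c a v u b
  Pf : Pent P f c a a' y d
  Pd : Pent P pd d y z t w
  Pz : Pent P pz z t x1 x2 x3
  EA : Exit P Q H M fA c
  Ef : Exit P Q H M f y
  Ed : Exit P Q H M pd d
  Ez : Exit P Q H M pz z
  H1 : h1 ∈ H
  H2 : h2 ∈ H
  H3 : h3 ∈ H
  hub : s(u, b) ∈ h1
  hva : s(v, a) ∈ h2
  haa : s(a, a') ∈ h2
  hwt : s(w, t) ∈ h3
  htx : s(t, x1) ∈ h3
  Mcd : s(c, d) ∈ M
  Myz : s(y, z) ∈ M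

theorem Pent.shared {P : PlaneGraph V} {f : Finset (Sym2 V)} {a b c d e : V}
    (hp : Pent P f a b c d e) {x y : V} (hx : s(x, y) ∈ f) (R : V → V → Prop)
    (hR : ∀ x y, R x y → R y x) (h : R x y) : R a b ∨ R b c ∨ R c d ∨ R d e ∨ R e a := by
  rw [hp.2.1] at hx
  simp only [Finset.mem_insert, Finset.mem_singleton, Sym2.eq_iff] at hx
  rcases hx with (⟨rfl, rfl⟩ | ⟨rfl, rfl⟩) | (⟨rfl, rfl⟩ | ⟨rfl, rfl⟩) | (⟨rfl, rfl⟩ | ⟨rfl, rfl⟩) |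
    (⟨rfl, rfl⟩ | ⟨rfl, rfl⟩) | (⟨rfl, rfl⟩ | ⟨rfl, rfl⟩)
  · exact Or.inl h
  · exact Or.inl (hR _ _ h)
  · exact Or.inr (Or.inl h)
  · exact Or.inr (Or.inl (hR _ _ h))
  · exact Or.inr (Or.inr (Or.inl h))
  · exact Or.inr (Or.inr (Or.inl (hR _ _ h)))
  · exact Or.inr (Or.inr (Or.inr (Or.inl h)))
  · exact Or.inr (Or.inr (Or.inr (Or.inl (hR _ _ h))))
  · exact Or.inr (Or.inr (Or.inr (Or.inr h)))
  · exact Or.inr (Or.inr (Or.inr (Or.inr (hR _ _ h))))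

theorem Pent.vert {P : PlaneGraph V} {f : Finset (Sym2 V)} {a b c d e : V}
    (hp : Pent P f a b c d e) {x y : V} (hx : s(x, y) ∈ f) :
    x = a ∨ x = b ∨ x = c ∨ x = d ∨ x = e := by
  rw [hp.2.1] at hx
  simp only [Finset.mem_insert, Finset.mem_singleton, Sym2.eq_iff] at hx
  rcases hx with (⟨h, -⟩ | ⟨h, -⟩) | (⟨h, -⟩ | ⟨h, -⟩) | (⟨h, -⟩ | ⟨h, -⟩) |
    (⟨h, -⟩ | ⟨h, -⟩) | (⟨h, -⟩ | ⟨h, -⟩) <;> simp [h]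

theorem two_faces (P : PlaneGraph V) {f g k : Finset (Sym2 V)} {x y : V} (hf : f ∈ P.faces)
    (hg : g ∈ P.faces) (hk : k ∈ P.faces) (hxf : s(x, y) ∈ f) (hxg : s(x, y) ∈ g)
    (hxk : s(x, y) ∈ k) (hfg : f ≠ g) : k = f ∨ k = g := by
  obtain ⟨g', -, -, -, hall⟩ := other_face P hf hxf
  have e1 := hall g hg hxg
  have e2 := hall k hk hxk
  grind

theorem Pent.ne {P : PlaneGraph V} {f : Finset (Sym2 V)} {a b c d e : V}
    (h : Pent P f a b c d e) :
    a ≠ b ∧ a ≠ c ∧ a ≠ d ∧ a ≠ e ∧ b ≠ c ∧ b ≠ d ∧ b ≠ e ∧ c ≠ d ∧ c ≠ e ∧ d ≠ e := by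
  have := h.2.2
  simp only [List.nodup_cons, List.mem_cons, List.not_mem_nil, not_or] at this
  obtain ⟨⟨h1, h2, h3, h4, -⟩, ⟨h5, h6, h7, -⟩, ⟨h8, h9, -⟩, ⟨h10, -⟩, -⟩ := this
  exact ⟨h1, h2, h3, h4, h5, h6, h7, h8, h9, h10⟩

theorem Hexa.ne {P : PlaneGraph V} {f : Finset (Sym2 V)} {a b c d e g : V}
    (h : Hexa P f a b c d e g) :
    a ≠ b ∧ a ≠ c ∧ a ≠ d ∧ a ≠ e ∧ a ≠ g ∧ b ≠ c ∧ b ≠ d ∧ b ≠ e ∧ b ≠ g ∧ c ≠ d ∧ c ≠ e ∧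
      c ≠ g ∧ d ≠ e ∧ d ≠ g ∧ e ≠ g := by
  have := h.2.2
  simp only [List.nodup_cons, List.mem_cons, List.not_mem_nil, not_or] at this
  obtain ⟨⟨h1, h2, h3, h4, h4', -⟩, ⟨h5, h6, h7, h7', -⟩, ⟨h8, h9, h9', -⟩, ⟨h10, h10', -⟩,
    ⟨h11, -⟩, -⟩ := this
  exact ⟨h1, h2, h3, h4, h4', h5, h6, h7, h7', h8, h9, h9', h10, h10', h11⟩

section
variable {P : PlaneGraph V} {Q H : Finset (Finset (Sym2 V))} {M : Finset (Sym2 V)} {u v : V}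

theorem TT.toH {x y : V} (h : TT H M x y) (S : Sys P Q H M) (hx : OnH H x) :
    ∃ h ∈ H, s(x, y) ∈ h := by
  rcases h with h | h
  · exact h
  · exact absurd hx (S.MH _ _ h)

theorem TT.inH {x y : V} (h : TT H M x y) (S : Sys P Q H M) {k : Finset (Sym2 V)} (hk : k ∈ H)
    {r : V} (hx : s(x, r) ∈ k) : s(x, y) ∈ k := by
  obtain ⟨k', hk', hy⟩ := h.toH S ⟨k, hk, r, hx⟩
  rw [S.Hd k hk k' hk' x r y hx hy]
  exact hy

theorem Sys.Qadj (S : Sys P Q H M) {q : Finset (Sym2 V)} (hq : q ∈ Q) {x y : V}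
    (h : s(x, y) ∈ q) : P.graph.Adj x y := by
  simpa using P.face_edges q (S.Qf q hq) _ h

theorem Sys.Madj (S : Sys P Q H M) {x y : V}
    (h : s(x, y) ∈ M) : P.graph.Adj x y := by
  obtain ⟨q, hq, hx⟩ := S.Mq x y h
  exact S.Qadj hq hx

theorem Sys.H_edge (S : Sys P Q H M) {f g h : Finset (Sym2 V)} {x y : V} (hf : f ∈ Q) (hg : g ∈ Q)
    (hh : h ∈ H) (hxf : s(x, y) ∈ f) (hxg : s(x, y) ∈ g) (hxh : s(x, y) ∈ h) : g = f := by
  rcases two_faces P (S.Qf f hf) (S.Hf h hh) (S.Qf g hg) hxf hxh hxg (S.hneq hf hh) with e | e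
  · exact e
  · exact absurd e (S.hneq hg hh)

theorem Sys.cov2 (S : Sys P Q H M) {f g : Finset (Sym2 V)} {x y z : V} (hf : f ∈ Q) (hg : g ∈ Q)
    (hcn : Cn P f x y z) (hgz : s(y, z) ∈ g) (hgf : g ≠ f) (hy : ¬ OnH H y) :
    ∃ m, s(y, m) ∈ M := by
  obtain ⟨w, hw⟩ := Cn.ext P (S.Qf g hg) (sw hgz)
  have hxw : x ≠ w := by
    rintro rfl
    exact hgf (hw.symm.uniq S.hP hcn)
  apply S.cov y _ hy
  intro r hr
  rcases nbrs P S.hP hcn.2.2.2 hxw hw.2.2.2 hcn.adj.1 hcn.adj.2 hw.adj.2 hr with rfl | rfl | rfl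
  · exact ⟨f, hf, sw hcn.2.1⟩
  · exact ⟨f, hf, hcn.2.2.1⟩
  · exact ⟨g, hg, hw.2.2.1⟩

theorem Sys.exit_noM (S : Sys P Q H M) {p : Finset (Sym2 V)} {x m : V} (h : Exit P Q H M p x)
    (hm : s(x, m) ∈ M) : s(x, m) ∉ p := by
  intro hp
  obtain ⟨-, y, z, hcn, hy, hz⟩ := h
  rcases hcn.det hp with rfl | rfl
  · exact hy (Or.inr hm)
  · exact hz (Or.inr hm)

theorem Sys.exit_corner (S : Sys P Q H M) {p : Finset (Sym2 V)} {x m y : V}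
    (h : Exit P Q H M p x) (hm : s(x, m) ∈ M) (hy : P.graph.Adj x y) (hym : y ≠ m) :
    ∃ w, Cn P p y x w ∧ w ≠ m := by
  have hno := S.exit_noM h hm
  obtain ⟨-, y', z', hcn, -, -⟩ := h
  have e1 : y' ≠ m := by rintro rfl; exact hno (sw hcn.2.1)
  have e2 : z' ≠ m := by rintro rfl; exact hno hcn.2.2.1
  rcases nbrs P S.hP hcn.2.2.2 e1 e2 hcn.adj.1 hcn.adj.2 (S.Madj hm) hy with rfl | rfl | rfl
  · exact ⟨z', hcn, e2⟩
  · exact ⟨y', hcn.symm, e1⟩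
  · exact absurd rfl hym

theorem Sys.MH2 (S : Sys P Q H M) {x y : V} (h : s(x, y) ∈ M) : ¬ OnH H y :=
  S.MH y x (sw h)

theorem core_of (S : Sys P Q H M) {fA f : Finset (Sym2 V)} {c a b d : V}
    (PA : Pent P fA c a v u b) (EA : Exit P Q H M fA c) (hu : OnH H u) (hv : OnH H v)
    (Mcd : s(c, d) ∈ M) (hf : f ∈ Q) (hcn : Cn P f d c a) : Nonempty (Core P Q H M u v) := by
  obtain ⟨t1, t2, t3, t4, t5⟩ := S.pattern EA PA
  obtain ⟨h2, H2, hva⟩ := t1.symm.toH S hv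
  obtain ⟨h1, H1, hub⟩ := t2.toH S hu
  obtain ⟨a', y, hp⟩ := pent_of_cn (S.Q5 f hf) hcn
  have hp' : Pent P f c d y a' a := hp.flip
  have Ef : Exit P Q H M f y := by
    rcases S.exit_of_tt hf hp' (Or.inr Mcd) with h | h
    · exact h
    · exact absurd ⟨h2, H2, v, sw hva⟩ (S.exit_notH h)
  have Pf : Pent P f c a a' y d := hp'.flip.rot
  obtain ⟨s1, s2, s3, s4, s5⟩ := S.pattern Ef hp'.rot.rot
  have haa : s(a, a') ∈ h2 := s1.symm.inH S H2 (sw hva)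
  obtain ⟨pd, Ed⟩ := S.exit_of hf (x := d) (w := c) hcn.2.1 (S.MH2 Mcd)
  have hdy : P.graph.Adj d y := hp'.cn.1.adj.2
  obtain ⟨w0, hw0, hw0c⟩ := S.exit_corner Ed (sw Mcd) hdy hp'.ne.2.1.symm
  have hpdf : pd ≠ f := by
    rintro rfl
    exact hp'.ne.2.2.2.2.1 (S.exit_uniq Ed Ef)
  have cy : Cn P f a' y d := hp'.cn.2.1.symm
  obtain ⟨z, Myz⟩ := S.cov2 hf Ed.1 cy hw0.2.1 hpdf (S.exit_notH Ef)
  have hza : z ≠ a' := by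
    rintro rfl
    exact s3 (Or.inr Myz)
  have hzd : z ≠ d := by
    rintro rfl
    exact s4 (Or.inr Myz)
  have cz : Cn P pd d y z := cy.other S.hP (S.Madj Myz) hza hzd hw0.1 hw0.2.1 hpdf
  obtain ⟨t, w, Pd⟩ := pent_of_cn (S.Q5 pd Ed.1) cz
  obtain ⟨r1, r2, r3, r4, r5⟩ := S.pattern Ed Pd
  obtain ⟨pz, Ez⟩ := S.exit_of Ed.1 (x := z) (w := y) (sw cz.2.2.1) (S.MH2 Myz)
  obtain ⟨x3, hx3, hx3y⟩ := S.exit_corner Ez (sw Myz) Pd.cn.2.1.adj.2 Pd.ne.2.2.2.2.2.1.symm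
  obtain ⟨x1, x2, Pz'⟩ := pent_of_cn (S.Q5 pz Ez.1) hx3.symm
  have Pz := Pz'.rot
  obtain ⟨q1, q2, q3, q4, q5⟩ := S.pattern Ez Pz
  have hpzd : pz ≠ pd := by
    rintro rfl
    exact hzd (S.exit_uniq Ez Ed)
  have hwx : w ≠ x1 := by
    rintro rfl
    exact hpzd (Pz.cn.1.uniq S.hP Pd.cn.2.2.1)
  have hh3 : ∃ h3 ∈ H, s(t, w) ∈ h3 := by
    rcases r2 with h | h
    · exact h
    · rcases q1 with ⟨k, hk, hk'⟩ | h'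
      · exact absurd ⟨k, hk, _, hk'⟩ (S.MH _ _ h)
      · exact absurd (S.Mm _ _ _ h h') hwx
  obtain ⟨h3, H3, htw⟩ := hh3
  exact ⟨⟨c, a, b, a', y, d, z, t, w, x1, x2, x3, fA, f, pd, pz, h1, h2, h3, PA, Pf, Pd, Pz,
    EA, Ef, Ed, Ez, H1, H2, H3, hub, hva, haa, sw htw, q1.inH S H3 htw, Mcd, Myz⟩⟩

theorem core_exists (S : Sys P Q H M) (E : Edg P Q H u v) (hc : 1 < Q.card) :
    Nonempty (Core P Q H M u v) ∨ Nonempty (Core P Q H M v u) := by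
  obtain ⟨fA, hfA, huv⟩ := E.ex
  have hT : ¬ TT H M v u := by
    intro h
    obtain ⟨k, hk, hk'⟩ := h.toH S E.onv
    exact E.noH k hk (sw hk')
  obtain ⟨b, c, a, hp⟩ := pent_of_edge P (S.Qf fA hfA) (S.Q5 fA hfA) (sw huv)
  have PA : Pent P fA c a v u b := hp.rot.rot.rot
  have EA : Exit P Q H M fA c := by
    rcases S.exit_cases hfA PA with h | h | h | h | h
    · exact h
    · exact absurd (S.pattern h PA.rot).1 hT
    · exact absurd E.onv (S.exit_notH h)
    · exact absurd E.onu (S.exit_notH h)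
    · exact absurd (S.pattern h PA.rot.rot.rot.rot).2.1 hT
  obtain ⟨t1, t2, t3, t4, t5⟩ := S.pattern EA PA
  obtain ⟨h2, H2, hva⟩ := t1.symm.toH S E.onv
  obtain ⟨h1, H1, hub⟩ := t2.toH S E.onu
  have hm : ∃ d, s(c, d) ∈ M := by
    by_contra hno
    have := E.conn (fun k => k = fA) (fun f hf hf' => E.bd f hf fA hfA hf' huv) (by
      rintro f hf rfl g hg x y hxf hxg
      by_contra hgf
      rcases PA.shared hxf (fun x y => s(x, y) ∈ g) (fun x y h => sw h) hxg with h | h | h | h | h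
      · exact hno (S.cov2 hf hg PA.cn.2.2.2.2 h hgf (S.exit_notH EA))
      · exact hgf (S.H_edge hf hg H2 PA.cn.1.2.2.1 h (sw hva))
      · exact hgf (E.bd g hg f hf (sw h) huv)
      · exact hgf (S.H_edge hf hg H1 PA.cn.2.2.1.2.2.1 h hub)
      · exact hno (S.cov2 hf hg PA.cn.2.2.2.2.symm (sw h) hgf (S.exit_notH EA)))
    have hsub : Q ⊆ {fA} := fun g hg => Finset.mem_singleton.2 (this g hg)
    have := Finset.card_le_card hsub
    simp at this
    omega
  obtain ⟨d, Mcd⟩ := hm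
  obtain ⟨f, hf, hcd⟩ := S.Mq _ _ Mcd
  obtain ⟨w, hw⟩ := Cn.ext P (S.Qf f hf) (sw hcd)
  have cA := PA.cn.2.2.2.2
  have hda : d ≠ a := by rintro rfl; exact t3 (Or.inr Mcd)
  have hdb : d ≠ b := by rintro rfl; exact t4 (Or.inr Mcd)
  rcases nbrs P S.hP cA.2.2.2 hdb.symm hda.symm cA.adj.1 cA.adj.2 (S.Madj Mcd) hw.adj.2
    with rfl | rfl | rfl
  · right
    exact core_of S PA.flip.rot EA E.onv E.onu Mcd hf hw
  · left
    exact core_of S PA EA E.onu E.onv Mcd hf hw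
  · exact absurd rfl hw.2.2.2

end

/-- The additional data of the six-pentagon configuration. -/
structure B3c (P : PlaneGraph V) (Q H : Finset (Finset (Sym2 V))) {M : Finset (Sym2 V)}
    {u v : V} (K : Core P Q H M u v) : Type where
  (x1' c' x2' a'' : V)
  (X q h4 : Finset (Sym2 V))
  XQ : X ∈ Q
  qQ : q ∈ Q
  PX : Pent P X K.x2 K.x1 x1' c' x2'
  Pq : Pent P q K.x3 K.z K.y K.a' a''
  H4 : h4 ∈ H
  hx1 : s(K.x1, x1') ∈ K.h3
  haa2 : s(K.a', a'') ∈ K.h2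
  hxc : s(x2', c') ∈ h4
  nX : X ≠ K.pz
  nq : q ≠ K.pz

section
variable {P : PlaneGraph V} {Q H : Finset (Finset (Sym2 V))} {M : Finset (Sym2 V)} {u v : V}

theorem Core.no_g (S : Sys P Q H M) (K : Core P Q H M u v) {k : Finset (Sym2 V)} (hk : k ∈ Q)
    (hcn : Cn P k K.b K.c K.d) : False := by
  have hkf : k ≠ K.f := by
    intro e
    rw [e] at hcn
    have h1 := hcn.symm.det' K.Pf.cn.2.2.2.2
    have h2 := K.PA.ne
    exact h2.2.2.2.2.2.2.1 h1
  have hpdf : K.pd ≠ K.f := by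
    intro e
    have h := K.Ed
    rw [e] at h
    exact K.Pf.ne.2.2.2.2.2.2.2.2.2 (S.exit_uniq K.Ef h)
  have c1 : Cn P k K.c K.d K.w :=
    Cn.third S.hP K.Pf.cn.2.2.2.1 K.Pd.cn.2.2.2.2.symm hpdf.symm hcn.1 (sw hcn.2.2.1) hkf
  obtain ⟨r, s, hp⟩ := pent_of_cn (S.Q5 k hk) c1
  have e := hp.cn.2.2.2.2.symm.det' hcn.symm
  subst e
  rcases S.exit_of_tt hk hp (Or.inr K.Mcd) with h | h
  · exact S.exit_notH h ⟨K.h3, K.H3, _, K.hwt⟩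
  · exact S.exit_notH h ⟨K.h1, K.H1, _, sw K.hub⟩

theorem Core.pd_f (S : Sys P Q H M) (K : Core P Q H M u v) : K.pd ≠ K.f := by
  intro e
  have h := K.Ed
  rw [e] at h
  exact K.Pf.ne.2.2.2.2.2.2.2.2.2 (S.exit_uniq K.Ef h)

theorem Core.pz_pd (S : Sys P Q H M) (K : Core P Q H M u v) : K.pz ≠ K.pd := by
  intro e
  have h := K.Ez
  rw [e] at h
  exact K.Pd.ne.2.1 (S.exit_uniq K.Ed h)

theorem Core.fA_f (S : Sys P Q H M) (K : Core P Q H M u v) : K.fA ≠ K.f := by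
  intro e
  have h := K.EA
  rw [e] at h
  exact K.Pf.ne.2.2.1 (S.exit_uniq h K.Ef)

theorem Core.dist4 (S : Sys P Q H M) (K : Core P Q H M u v) :
    K.c ≠ K.d ∧ K.c ≠ K.y ∧ K.c ≠ K.z ∧ K.d ≠ K.y ∧ K.d ≠ K.z ∧ K.y ≠ K.z := by
  have n1 := K.Pf.ne
  have n2 := K.Pd.ne
  refine ⟨n1.2.2.2.1, n1.2.2.1, ?_, n2.1, n2.2.1, n2.2.2.2.2.1⟩
  intro e
  have h := K.Mcd
  rw [e] at h
  exact n2.1 (S.Mm _ _ _ h (sw K.Myz))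

theorem Core.cb (S : Sys P Q H M) (K : Core P Q H M u v) : K.d ≠ K.a ∧ K.d ≠ K.b := by
  obtain ⟨-, -, t3, t4, -⟩ := S.pattern K.EA K.PA
  constructor
  · intro e
    exact t3 (Or.inr (e ▸ K.Mcd))
  · intro e
    exact t4 (Or.inr (e ▸ K.Mcd))

theorem Core.onH (K : Core P Q H M u v) :
    OnH H K.a ∧ OnH H K.b ∧ OnH H u ∧ OnH H v ∧ OnH H K.a' ∧ OnH H K.w ∧ OnH H K.t ∧ OnH H K.x1 :=
  ⟨⟨_, K.H2, _, K.haa⟩, ⟨_, K.H1, _, sw K.hub⟩, ⟨_, K.H1, _, K.hub⟩, ⟨_, K.H2, _, K.hva⟩,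
    ⟨_, K.H2, _, sw K.haa⟩, ⟨_, K.H3, _, K.hwt⟩, ⟨_, K.H3, _, K.htx⟩, ⟨_, K.H3, _, sw K.htx⟩⟩

/-- If `x2 x3` is a matching edge, then we have six different vertices in `U`. -/
theorem Core.dist6 (S : Sys P Q H M) (K : Core P Q H M u v) (hM : s(K.x2, K.x3) ∈ M) :
    (K.x2 ≠ K.c ∧ K.x2 ≠ K.d ∧ K.x2 ≠ K.y ∧ K.x2 ≠ K.z) ∧
    (K.x3 ≠ K.c ∧ K.x3 ≠ K.d ∧ K.x3 ≠ K.y ∧ K.x3 ≠ K.z) ∧ K.x2 ≠ K.x3 := by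
  have n1 := K.Pz.ne
  have n2 := K.dist4 S
  have hzx : P.graph.Adj K.x3 K.z := K.Pz.cn.2.2.2.1.adj.2
  have hzH : ¬ OnH H K.z := S.exit_notH K.Ez
  have a1 : K.x2 ≠ K.z := n1.2.2.1.symm
  have a2 : K.x3 ≠ K.z := n1.2.2.2.1.symm
  have a3 : K.x3 ≠ K.c := by
    intro e
    rw [e] at hzx
    have cA := K.PA.cn.2.2.2.2
    rcases nbrs P S.hP cA.2.2.2 (K.cb S).2.symm (K.cb S).1.symm cA.adj.1 cA.adj.2 (S.Madj K.Mcd) hzx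
      with h | h | h
    · exact hzH (h ▸ K.onH.2.1)
    · exact hzH (h ▸ K.onH.1)
    · exact n2.2.2.2.2.1 h.symm
  have a4 : K.x3 ≠ K.d := by
    intro e
    rw [e] at hzx
    have cA := K.Pd.cn.2.2.2.2
    have hcw : K.c ≠ K.w := by
      intro e'
      exact S.exit_notH K.EA (e' ▸ K.onH.2.2.2.2.2.1)
    rcases nbrs P S.hP cA.2.2.2 hcw.symm n2.2.1.symm cA.adj.1 cA.adj.2 (S.Madj K.Mcd).symm hzx
      with h | h | h
    · exact hzH (h ▸ K.onH.2.2.2.2.2.1)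
    · exact n2.2.2.2.2.2 h.symm
    · exact n2.2.2.1 h.symm
  have a5 : K.x3 ≠ K.y := by
    intro e
    have h := sw hM
    rw [e] at h
    exact a1 (S.Mm _ _ _ h K.Myz)
  refine ⟨⟨?_, ?_, ?_, a1⟩, ⟨a3, a4, a5, a2⟩, n1.2.2.2.2.2.2.2.2.2⟩
  · intro e
    have h := hM
    rw [e] at h
    exact a4 (S.Mm _ _ _ h K.Mcd)
  · intro e
    have h := hM
    rw [e] at h
    exact a3 (S.Mm _ _ _ h (sw K.Mcd))
  · intro e
    have h := hM
    rw [e] at h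
    exact a2 (S.Mm _ _ _ h K.Myz)

theorem Sys.card6 (S : Sys P Q H M) {x : V} {l : List V} (hl : l.Nodup)
    (h : ∀ x ∈ l, ¬ OnH H x ∧ ∃ q ∈ Q, ∃ w, s(x, w) ∈ q) (hx : Q.card ≤ l.length)
    (hU : ¬ OnH H x ∧ ∃ q ∈ Q, ∃ w, s(x, w) ∈ q) : x ∈ l := by
  by_contra hxl
  have h1 := S.Ucard (x :: l).toFinset (by
    intro y hy
    rw [List.mem_toFinset, List.mem_cons] at hy
    rcases hy with rfl | hy
    · exact hU
    · exact h y hy)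
  rw [List.toFinset_card_of_nodup (List.nodup_cons.2 ⟨hxl, hl⟩), List.length_cons] at h1
  omega

theorem Sys.card_le (S : Sys P Q H M) {l : List V} (hl : l.Nodup)
    (h : ∀ x ∈ l, ¬ OnH H x ∧ ∃ q ∈ Q, ∃ w, s(x, w) ∈ q) : l.length ≤ Q.card := by
  have h1 := S.Ucard l.toFinset (by
    intro y hy
    rw [List.mem_toFinset] at hy
    exact h y hy)
  rwa [List.toFinset_card_of_nodup hl] at h1

theorem Sys.exitU (S : Sys P Q H M) {p : Finset (Sym2 V)} {x : V} (h : Exit P Q H M p x) :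
    ¬ OnH H x ∧ ∃ q ∈ Q, ∃ w, s(x, w) ∈ q := by
  refine ⟨S.exit_notH h, ?_⟩
  obtain ⟨hp, y, z, hcn, -⟩ := h
  exact ⟨p, hp, z, hcn.2.2.1⟩

theorem Sys.MU (S : Sys P Q H M) {x y : V} (h : s(x, y) ∈ M) :
    ¬ OnH H x ∧ ∃ q ∈ Q, ∃ w, s(x, w) ∈ q := by
  refine ⟨S.MH _ _ h, ?_⟩
  obtain ⟨q, hq, hx⟩ := S.Mq _ _ h
  exact ⟨q, hq, y, hx⟩

theorem Core.six (S : Sys P Q H M) (K : Core P Q H M u v) (hM : s(K.x2, K.x3) ∈ M) :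
    [K.c, K.d, K.y, K.z, K.x2, K.x3].Nodup ∧
    ∀ x ∈ [K.c, K.d, K.y, K.z, K.x2, K.x3], ¬ OnH H x ∧ ∃ q ∈ Q, ∃ w, s(x, w) ∈ q := by
  obtain ⟨⟨a1, a2, a3, a4⟩, ⟨b1, b2, b3, b4⟩, c1⟩ := K.dist6 S hM
  obtain ⟨d1, d2, d3, d4, d5, d6⟩ := K.dist4 S
  constructor
  · simp only [List.nodup_cons, List.mem_cons, List.not_mem_nil, not_or, List.nodup_nil,
      not_false_eq_true, and_true]
    exact ⟨⟨d1, d2, d3, a1.symm, b1.symm⟩, ⟨d4, d5, a2.symm, b2.symm⟩, ⟨d6, a3.symm, b3.symm⟩,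
      ⟨a4.symm, b4.symm⟩, c1⟩
  · intro x hx
    simp only [List.mem_cons, List.not_mem_nil, or_false] at hx
    rcases hx with rfl | rfl | rfl | rfl | rfl | rfl
    · exact S.exitU K.EA
    · exact S.exitU K.Ed
    · exact S.exitU K.Ef
    · exact S.exitU K.Ez
    · exact S.MU hM
    · exact S.MU (sw hM)

theorem Core.k4 (S : Sys P Q H M) (K : Core P Q H M u v) (hc : Q.card = 4) :
    ∃ h4 ∈ H, s(K.x2, K.x3) ∈ h4 := by
  rcases (S.pattern K.Ez K.Pz).2.1 with h | h
  · exact h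
  · obtain ⟨h1, h2⟩ := K.six S h
    have := S.card_le h1 h2
    simp at this
    omega

theorem Core.no_q (S : Sys P Q H M) (K : Core P Q H M u v) (hx3 : OnH H K.x3)
    {k : Finset (Sym2 V)} (hk : k ∈ Q) (hkd : k ≠ K.pd) (hyz : s(K.y, K.z) ∈ k) : False := by
  have c1 : Cn P k K.z K.y K.a' :=
    Cn.third S.hP K.Pd.cn.1 K.Pf.cn.2.2.1.symm (K.pd_f S) (S.Qf k hk) hyz hkd
  have c2 : Cn P k K.y K.z K.x3 :=
    Cn.third S.hP K.Pd.cn.2.1.symm K.Pz.cn.2.2.2.2.symm (K.pz_pd S).symm (S.Qf k hk) (sw hyz) hkd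
  obtain ⟨r, s, hp⟩ := pent_of_cn (S.Q5 k hk) c2
  have e := hp.cn.2.2.2.2.symm.det' c1
  subst e
  rcases S.exit_of_tt hk hp (Or.inr K.Myz) with h | h
  · exact S.exit_notH h hx3
  · exact S.exit_notH h K.onH.2.2.2.2.1

/-- Faces around the four pentagons in the case that `x2 x3` is a hexagon edge. -/
theorem Core.closed4 (S : Sys P Q H M) (E : Edg P Q H u v) (K : Core P Q H M u v)
    {h4 : Finset (Sym2 V)} (H4 : h4 ∈ H) (hx : s(K.x2, K.x3) ∈ h4) {k g : Finset (Sym2 V)}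
    (hk : k = K.fA ∨ k = K.f ∨ k = K.pd ∨ k = K.pz) (hg : g ∈ Q) {x y : V} (hxk : s(x, y) ∈ k)
    (hxg : s(x, y) ∈ g) :
    (g = K.fA ∨ g = K.f ∨ g = K.pd ∨ g = K.pz) ∨ s(K.x1, K.x2) ∈ g := by
  have hx3 : OnH H K.x3 := ⟨h4, H4, _, sw hx⟩
  have gf := S.Qf g hg
  have cA := K.PA.cn
  have cf := K.Pf.cn
  have cd := K.Pd.cn
  have cz := K.Pz.cn
  by_contra hcon
  simp only [not_or] at hcon
  obtain ⟨⟨n1, n2, n3, n4⟩, n5⟩ := hcon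
  have hcd : s(K.c, K.d) ∉ g := fun h =>
    K.no_g S hg (Cn.third S.hP cf.2.2.2.2.symm cA.2.2.2.2.symm (K.fA_f S).symm gf h n2).symm
  have hyz : s(K.y, K.z) ∉ g := fun h => K.no_q S hx3 hg n3 h
  rcases hk with rfl | rfl | rfl | rfl
  · rcases K.PA.shared hxk (fun x y => s(x, y) ∈ g) (fun x y h => sw h) hxg with h | h | h | h | h
    · rcases two_faces P cA.1.1 cf.1.1 gf cA.2.2.2.2.2.2.1 cf.1.2.1 h (K.fA_f S) with e | e
      · exact n1 e
      · exact n2 e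
    · exact n1 (S.H_edge K.EA.1 hg K.H2 cA.1.2.2.1 h (sw K.hva))
    · exact n1 (E.bd g hg _ K.EA.1 (sw h) (sw cA.2.1.2.2.1))
    · exact n1 (S.H_edge K.EA.1 hg K.H1 cA.2.2.1.2.2.1 h K.hub)
    · exact hcd (Cn.third S.hP cA.2.2.2.2.symm cf.2.2.2.2.symm (K.fA_f S) gf (sw h) n1).2.2.1
  · rcases K.Pf.shared hxk (fun x y => s(x, y) ∈ g) (fun x y h => sw h) hxg with h | h | h | h | h
    · rcases two_faces P cA.1.1 cf.1.1 gf cA.2.2.2.2.2.2.1 cf.1.2.1 h (K.fA_f S) with e | e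
      · exact n1 e
      · exact n2 e
    · exact n2 (S.H_edge K.Ef.1 hg K.H2 cf.1.2.2.1 h K.haa)
    · exact hyz (Cn.third S.hP cf.2.2.1.symm cd.1 (K.pd_f S).symm gf (sw h) n2).2.2.1
    · rcases two_faces P cd.1.1 cf.1.1 gf (sw cd.1.2.1) cf.2.2.1.2.2.1 h (K.pd_f S) with e | e
      · exact n3 e
      · exact n2 e
    · exact hcd (sw h)
  · rcases K.Pd.shared hxk (fun x y => s(x, y) ∈ g) (fun x y h => sw h) hxg with h | h | h | h | h
    · rcases two_faces P cd.1.1 cf.1.1 gf (sw cd.1.2.1) cf.2.2.1.2.2.1 (sw h) (K.pd_f S) with e | e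
      · exact n3 e
      · exact n2 e
    · exact hyz h
    · rcases two_faces P cz.1.1 cd.1.1 gf cz.1.2.1 cd.2.1.2.2.1 h (K.pz_pd S) with e | e
      · exact n4 e
      · exact n3 e
    · exact n3 (S.H_edge K.Ed.1 hg K.H3 cd.2.2.1.2.2.1 h (sw K.hwt))
    · exact hcd (sw (Cn.third S.hP cd.2.2.2.2.symm cf.2.2.2.1.symm.symm (K.pd_f S)
        gf (sw h) n3).2.2.1)
  · rcases K.Pz.shared hxk (fun x y => s(x, y) ∈ g) (fun x y h => sw h) hxg with h | h | h | h | h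
    · rcases two_faces P cz.1.1 cd.1.1 gf cz.1.2.1 cd.2.1.2.2.1 h (K.pz_pd S) with e | e
      · exact n4 e
      · exact n3 e
    · exact n4 (S.H_edge K.Ez.1 hg K.H3 cz.1.2.2.1 h K.htx)
    · exact n5 h
    · exact n4 (S.H_edge K.Ez.1 hg H4 cz.2.2.1.2.2.1 h hx)
    · exact hyz (sw (Cn.third S.hP cz.2.2.2.2.symm cd.2.1.symm (K.pz_pd S) gf (sw h) n4).2.2.1)

theorem Core.start (S : Sys P Q H M) (E : Edg P Q H u v) (K : Core P Q H M u v)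
    {f : Finset (Sym2 V)} (hf : f ∈ Q) (h : s(u, v) ∈ f) : f = K.fA :=
  E.bd f hf _ K.EA.1 h (sw K.PA.cn.2.1.2.2.1)

theorem Core.k6 (S : Sys P Q H M) (E : Edg P Q H u v) (K : Core P Q H M u v) (hc : Q.card = 6) :
    s(K.x2, K.x3) ∈ M := by
  obtain ⟨-, T23, -, -, nT⟩ := S.pattern K.Ez K.Pz
  rcases T23 with ⟨h4, H4, hx⟩ | h
  swap
  · exact h
  exfalso
  have cz := K.Pz.cn
  by_cases hX : ∃ X ∈ Q, X ≠ K.pz ∧ s(K.x1, K.x2) ∈ X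
  swap
  · have := E.conn (fun k => k = K.fA ∨ k = K.f ∨ k = K.pd ∨ k = K.pz)
      (fun f hf h => Or.inl (K.start S E hf h)) (by
      intro f hf hk g hg x y hxf hxg
      rcases K.closed4 S E H4 hx hk hg hxf hxg with h | h
      · exact h
      · by_contra hcon
        exact hX ⟨g, hg, fun e => hcon (by simp [e]), h⟩)
    have hsub : Q ⊆ ([K.fA, K.f, K.pd, K.pz] : List _).toFinset := by
      intro g hg
      have := this g hg
      simp only [List.mem_toFinset, List.mem_cons, List.not_mem_nil, or_false]
      exact this
    have h1 := Finset.card_le_card hsub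
    have h2 := List.toFinset_card_le ([K.fA, K.f, K.pd, K.pz] : List _)
    simp only [List.length_cons, List.length_nil] at h2
    omega
  obtain ⟨X, XQ, Xz, hxX⟩ := hX
  obtain ⟨x2', c', x1', PX⟩ := pent_of_edge P (S.Qf X XQ) (S.Q5 X XQ) hxX
  have cX := PX.cn
  have k3 : Cn P K.h3 K.t K.x1 x1' := Cn.third S.hP cz.2.1.symm cX.2.2.2.2.symm Xz.symm
    (S.Hf _ K.H3) (sw K.htx) (S.hneq K.Ez.1 K.H3).symm
  have k4 : Cn P h4 K.x3 K.x2 x2' := Cn.third S.hP cz.2.2.1 cX.1 Xz.symm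
    (S.Hf _ H4) hx (S.hneq K.Ez.1 H4).symm
  have hx1 : OnH H K.x1 := K.onH.2.2.2.2.2.2.2
  have hx2 : OnH H K.x2 := ⟨h4, H4, _, hx⟩
  have EX : Exit P Q H M X c' := by
    rcases S.exit_cases XQ PX with h | h | h | h | h
    · exact absurd hx1 (S.exit_notH h)
    · exact absurd hx2 (S.exit_notH h)
    · exact absurd ⟨h4, H4, _, sw k4.2.2.1⟩ (S.exit_notH h)
    · exact h
    · exact absurd ⟨K.h3, K.H3, _, sw k3.2.2.1⟩ (S.exit_notH h)
  have hR : ∀ x y, (OnH H x ∧ OnH H y ∧ ¬ TT H M x y ∧ s(x, y) ∈ K.pz) →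
      (OnH H y ∧ OnH H x ∧ ¬ TT H M y x ∧ s(y, x) ∈ K.pz) :=
    fun x y h => ⟨h.2.1, h.1, fun t => h.2.2.1 t.symm, sw h.2.2.2⟩
  have hR0 : OnH H K.x1 ∧ OnH H K.x2 ∧ ¬ TT H M K.x1 K.x2 ∧ s(K.x1, K.x2) ∈ K.pz :=
    ⟨hx1, hx2, nT, cz.2.1.2.2.1⟩
  have ncH := S.exit_notH K.EA
  have ndH := S.exit_notH K.Ed
  have nyH := S.exit_notH K.Ef
  have nzH := S.exit_notH K.Ez
  have XA : X ≠ K.fA := by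
    rintro rfl
    rcases K.PA.shared hxX (fun x y => OnH H x ∧ OnH H y ∧ ¬ TT H M x y ∧ s(x, y) ∈ K.pz) hR hR0
      with h | h | h | h | h
    · exact ncH h.1
    · exact h.2.2.1 (Or.inl ⟨_, K.H2, sw K.hva⟩)
    · exact Xz (K.start S E K.Ez.1 (sw h.2.2.2)).symm
    · exact h.2.2.1 (Or.inl ⟨_, K.H1, K.hub⟩)
    · exact ncH h.2.1
  have Xf : X ≠ K.f := by
    rintro rfl
    rcases K.Pf.shared hxX (fun x y => OnH H x ∧ OnH H y ∧ ¬ TT H M x y ∧ s(x, y) ∈ K.pz) hR hR0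
      with h | h | h | h | h
    · exact ncH h.1
    · exact h.2.2.1 (Or.inl ⟨_, K.H2, K.haa⟩)
    · exact nyH h.2.1
    · exact nyH h.1
    · exact ncH h.2.1
  have Xd : X ≠ K.pd := by
    rintro rfl
    rcases K.Pd.shared hxX (fun x y => OnH H x ∧ OnH H y ∧ ¬ TT H M x y ∧ s(x, y) ∈ K.pz) hR hR0
      with h | h | h | h | h
    · exact ndH h.1
    · exact nyH h.1
    · exact nzH h.1
    · exact h.2.2.1 (Or.inl ⟨_, K.H3, sw K.hwt⟩)
    · exact ndH h.2.1
  have e1 : c' ≠ K.c := by rintro rfl; exact XA (S.exit_inj EX K.EA)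
  have e2 : c' ≠ K.d := by rintro rfl; exact Xd (S.exit_inj EX K.Ed)
  have e3 : c' ≠ K.y := by rintro rfl; exact Xf (S.exit_inj EX K.Ef)
  have e4 : c' ≠ K.z := by rintro rfl; exact Xz (S.exit_inj EX K.Ez)
  by_cases hm : ∃ d', s(c', d') ∈ M
  · obtain ⟨d', hd'⟩ := hm
    have f1 : d' ≠ K.c := by rintro rfl; exact e2 (S.Mm _ _ _ (sw hd') K.Mcd)
    have f2 : d' ≠ K.d := by rintro rfl; exact e1 (S.Mm _ _ _ (sw hd') (sw K.Mcd))
    have f3 : d' ≠ K.y := by rintro rfl; exact e4 (S.Mm _ _ _ (sw hd') K.Myz)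
    have f4 : d' ≠ K.z := by rintro rfl; exact e3 (S.Mm _ _ _ (sw hd') (sw K.Myz))
    have f5 : c' ≠ d' := (S.Madj hd').ne
    obtain ⟨d1, d2, d3, d4, d5, d6⟩ := K.dist4 S
    obtain ⟨k, hk, hck⟩ := S.Mq _ _ hd'
    obtain ⟨x, hxe⟩ := S.exit_exists hk
    have hmem : x ∈ [K.c, K.d, K.y, K.z, c', d'] := by
      apply S.card6 _ _ _ (S.exitU hxe)
      · simp only [List.nodup_cons, List.mem_cons, List.not_mem_nil, not_or, List.nodup_nil,
          not_false_eq_true, and_true]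
        exact ⟨⟨d1, d2, d3, e1.symm, f1.symm⟩, ⟨d4, d5, e2.symm, f2.symm⟩, ⟨d6, e3.symm, f3.symm⟩,
          ⟨e4.symm, f4.symm⟩, f5⟩
      · intro x hx
        simp only [List.mem_cons, List.not_mem_nil, or_false] at hx
        rcases hx with rfl | rfl | rfl | rfl | rfl | rfl
        · exact S.exitU K.EA
        · exact S.exitU K.Ed
        · exact S.exitU K.Ef
        · exact S.exitU K.Ez
        · exact S.MU hd'
        · exact S.MU (sw hd')
      · simp [hc]
    have ncc := S.MH _ _ hd'
    obtain ⟨o1, o2, o3, o4, o5, o6, o7, o8⟩ := K.onH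
    simp only [List.mem_cons, List.not_mem_nil, or_false] at hmem
    rcases hmem with rfl | rfl | rfl | rfl | rfl | rfl
    · have := S.exit_inj hxe K.EA
      subst this
      rcases K.PA.vert hck with h | h | h | h | h
      · exact e1 h
      all_goals (rw [h] at ncc; exact ncc (by assumption))
    · have := S.exit_inj hxe K.Ed
      subst this
      rcases K.Pd.vert hck with h | h | h | h | h
      · exact e2 h
      · exact e3 h
      · exact e4 h
      all_goals (rw [h] at ncc; exact ncc (by assumption))
    · have := S.exit_inj hxe K.Ef
      subst this
      rcases K.Pf.vert hck with h | h | h | h | h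
      · exact e1 h
      · rw [h] at ncc; exact ncc o1
      · rw [h] at ncc; exact ncc o5
      · exact e3 h
      · exact e2 h
    · have := S.exit_inj hxe K.Ez
      subst this
      rcases K.Pz.vert hck with h | h | h | h | h
      · exact e4 h
      · rw [h] at ncc; exact ncc o7
      · rw [h] at ncc; exact ncc o8
      · rw [h] at ncc; exact ncc hx2
      · rw [h] at ncc; exact ncc ⟨h4, H4, _, sw hx⟩
    · exact S.exit_noM hxe hd' hck
    · exact S.exit_noM hxe (sw hd') (sw hck)
  · have := E.conn (fun k => (k = K.fA ∨ k = K.f ∨ k = K.pd ∨ k = K.pz) ∨ k = X)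
      (fun f hf h => Or.inl (Or.inl (K.start S E hf h))) (by
      intro f hf hk g hg x y hxf hxg
      have h12 : s(K.x1, K.x2) ∈ g → (g = K.fA ∨ g = K.f ∨ g = K.pd ∨ g = K.pz) ∨ g = X := by
        intro h
        rcases two_faces P cz.1.1 cX.1.1 (S.Qf g hg) cz.2.1.2.2.1 hxX h Xz.symm with e | e
        · simp [e]
        · simp [e]
      rcases hk with hk | rfl
      · rcases K.closed4 S E H4 hx hk hg hxf hxg with h | h
        · exact Or.inl h
        · exact h12 h
      · by_cases hgX : g = f
        · exact Or.inr hgX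
        rcases PX.shared hxf (fun x y => s(x, y) ∈ g) (fun x y h => sw h) hxg
          with h | h | h | h | h
        · exact h12 h
        · exact absurd (S.H_edge XQ hg H4 cX.1.2.2.1 h k4.2.2.1) hgX
        · exact absurd (S.cov2 XQ hg cX.2.2.1.symm (sw h) hgX (S.exit_notH EX)) hm
        · exact absurd (S.cov2 XQ hg cX.2.2.1 h hgX (S.exit_notH EX)) hm
        · exact absurd (S.H_edge XQ hg K.H3 cX.2.2.2.2.2.1 h (sw k3.2.2.1)) hgX)
    have hsub : Q ⊆ ([K.fA, K.f, K.pd, K.pz, X] : List _).toFinset := by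
      intro g hg
      have := this g hg
      simp only [List.mem_toFinset, List.mem_cons, List.not_mem_nil, or_false]
      tauto
    have h1 := Finset.card_le_card hsub
    have h2 := List.toFinset_card_le ([K.fA, K.f, K.pd, K.pz, X] : List _)
    simp only [List.length_cons, List.length_nil] at h2
    omega

theorem Core.b3 (S : Sys P Q H M) (K : Core P Q H M u v) (hc : Q.card = 6)
    (hM : s(K.x2, K.x3) ∈ M) : Nonempty (B3c P Q H K) := by
  obtain ⟨hnd, hU⟩ := K.six S hM
  obtain ⟨⟨a1, a2, a3, a4⟩, ⟨b1, b2, b3, b4⟩, c1⟩ := K.dist6 S hM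
  have cz := K.Pz.cn
  have cd := K.Pd.cn
  have cf := K.Pf.cn
  obtain ⟨q, Eq⟩ := S.exit_of K.Ez.1 (x := K.x3) (w := K.z) cz.2.2.2.2.2.1
    (S.MH2 hM)
  obtain ⟨r, hr, -⟩ := S.exit_corner Eq (sw hM) cz.2.2.2.1.adj.2 a4.symm
  have qz : q ≠ K.pz := by
    rintro rfl
    exact b4 (S.exit_uniq Eq K.Ez)
  have qd : q ≠ K.pd := by
    rintro rfl
    exact b2 (S.exit_uniq Eq K.Ed)
  have cq1 : Cn P q K.x3 K.z K.y := Cn.third S.hP cz.2.2.2.2.symm cd.2.1.symm (K.pz_pd S)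
    hr.1 hr.2.1 qz
  have cq2 : Cn P q K.z K.y K.a' := Cn.third S.hP cd.1 cf.2.2.1.symm (K.pd_f S) hr.1
    (sw cq1.2.2.1) qd
  obtain ⟨s1, a'', Pq⟩ := pent_of_cn (S.Q5 q Eq.1) cq1
  have e := Pq.cn.2.1.det' cq2
  subst e
  have haa2 : s(K.a', a'') ∈ K.h2 := (S.pattern Eq Pq).2.1.inH S K.H2 (sw K.haa)
  obtain ⟨X, EX⟩ := S.exit_of K.Ez.1 (x := K.x2) (w := K.x3) cz.2.2.1.2.2.1 (S.MH _ _ hM)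
  obtain ⟨x2', hX, hX3⟩ := S.exit_corner EX hM cz.2.2.1.adj.1 cz.2.2.1.2.2.2
  obtain ⟨x1', c', PX'⟩ := pent_of_cn (S.Q5 X EX.1) hX.symm
  have PX := PX'.rot
  have Xz : X ≠ K.pz := by
    rintro rfl
    exact a4 (S.exit_uniq EX K.Ez)
  obtain ⟨t1, t2, t3, t4, t5⟩ := S.pattern EX PX
  have hx1 : s(K.x1, x1') ∈ K.h3 := t1.inH S K.H3 (sw K.htx)
  have hne := PX.ne
  have h4 : ∃ h4 ∈ H, s(c', x2') ∈ h4 := by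
    rcases t2 with h | h
    · exact h
    · exfalso
      have m1 := S.card6 hnd hU (by simp [hc]) (S.MU h)
      have hcd : s(K.c, K.d) ∉ X := by
        intro hx
        have Xf : X ≠ K.f := by
          rintro rfl
          exact a3 (S.exit_uniq EX K.Ef)
        exact K.no_g S EX.1 (Cn.third S.hP cf.2.2.2.2.symm K.PA.cn.2.2.2.2.symm (K.fA_f S).symm
          hX.1 hx Xf).symm
      have hyz : s(K.y, K.z) ∉ X := by
        intro hx
        rcases two_faces P cd.1.1 cq1.1 hX.1 cd.1.2.2.1 (sw cq1.2.2.1) hx qd.symm with e | e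
        · exact a2 (S.exit_uniq (e ▸ EX) K.Ed)
        · exact c1 (S.exit_uniq (e ▸ EX) Eq)
      have hcx : s(c', x2') ∈ X := PX.cn.2.2.1.2.2.1
      simp only [List.mem_cons, List.not_mem_nil, or_false] at m1
      rcases m1 with rfl | rfl | rfl | rfl | rfl | rfl
      · rw [S.Mm _ _ _ h K.Mcd] at hcx
        exact hcd hcx
      · rw [S.Mm _ _ _ h (sw K.Mcd)] at hcx
        exact hcd (sw hcx)
      · rw [S.Mm _ _ _ h K.Myz] at hcx
        exact hyz hcx
      · rw [S.Mm _ _ _ h (sw K.Myz)] at hcx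
        exact hyz (sw hcx)
      · exact hne.2.2.1 rfl
      · exact hne.2.2.2.1 (S.Mm _ _ _ h (sw hM)).symm
  obtain ⟨h4, H4, hxc⟩ := h4
  exact ⟨⟨x1', c', x2', a'', X, q, h4, EX.1, Eq.1, PX, Pq, H4, hx1, haa2, sw hxc, Xz, qz⟩⟩

end

/-! ### Consequences of the configurations -/

section
variable {P : PlaneGraph V} {Q H : Finset (Finset (Sym2 V))} {M : Finset (Sym2 V)} {u v : V}

theorem Core.ne_fA (S : Sys P Q H M) (K : Core P Q H M u v) :
    K.f ≠ K.fA ∧ K.pd ≠ K.fA ∧ K.pz ≠ K.fA := by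
  obtain ⟨d1, d2, d3, -⟩ := K.dist4 S
  refine ⟨?_, ?_, ?_⟩
  · intro e
    have h := K.Ef
    rw [e] at h
    exact d2 (S.exit_uniq K.EA h)
  · intro e
    have h := K.Ed
    rw [e] at h
    exact d1 (S.exit_uniq K.EA h)
  · intro e
    have h := K.Ez
    rw [e] at h
    exact d3 (S.exit_uniq K.EA h)

theorem Core.fA_vert (K : Core P Q H M u v) {x y : V} (h : s(x, y) ∈ K.fA) (hx : ¬ OnH H x) :
    x = K.c := by
  obtain ⟨o1, o2, o3, o4, -⟩ := K.onH
  rcases K.PA.vert h with e | e | e | e | e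
  · exact e
  · exact absurd (e ▸ o1) hx
  · exact absurd (e ▸ o4) hx
  · exact absurd (e ▸ o3) hx
  · exact absurd (e ▸ o2) hx

/-- Corners of the Clar hexagons. -/
theorem Core.corners (S : Sys P Q H M) (K : Core P Q H M u v) :
    Cn P K.h2 v K.a K.a' ∧ Cn P K.h3 K.w K.t K.x1 := by
  constructor
  · refine ⟨S.Hf _ K.H2, K.hva, K.haa, ?_⟩
    intro e
    have c1 := K.PA.cn.1
    have c2 := K.Pf.cn.1
    rw [← e] at c2
    exact K.fA_f S (c1.uniq S.hP c2)
  · refine ⟨S.Hf _ K.H3, K.hwt, K.htx, ?_⟩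
    intro e
    have c1 := K.Pd.cn.2.2.1
    have c2 := K.Pz.cn.1
    rw [← e] at c2
    exact K.pz_pd S (c2.uniq S.hP c1)

/-- The face at `b c d`. -/
theorem Core.gface (S : Sys P Q H M) (K : Core P Q H M u v) {β : V} (hβ : Cn P K.h1 u K.b β) :
    ∃ g ω, Hexa P g β K.b K.c K.d K.w ω ∧ Cn P K.h3 K.t K.w ω ∧ g ∉ H := by
  have cA := K.PA.cn
  have cf := K.Pf.cn
  have cd := K.Pd.cn
  have ncH := S.exit_notH K.EA
  obtain ⟨g, hg, hgA, hgbc, -⟩ := other_face P (S.Qf _ K.EA.1) cA.2.2.2.1.2.2.1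
  have gc : Cn P g K.b K.c K.d :=
    Cn.third S.hP cA.2.2.2.2.symm cf.2.2.2.2.symm (K.fA_f S) hg (sw hgbc) hgA
  have hgH : g ∉ H := fun h => ncH ⟨g, h, _, gc.2.2.1⟩
  have hgf : g ≠ K.f := by
    intro e
    rw [e] at gc
    exact K.PA.ne.2.2.2.2.2.2.1 (gc.symm.det' cf.2.2.2.2)
  have gd : Cn P g K.c K.d K.w :=
    Cn.third S.hP cf.2.2.2.1 cd.2.2.2.2.symm (K.pd_f S).symm hg (sw gc.2.2.1) hgf
  have hgd : g ≠ K.pd := by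
    intro e
    rw [e] at gd
    exact K.Pf.ne.2.2.1 (cd.2.2.2.2.det' gd.symm).symm.symm
  obtain ⟨ω, hω⟩ := Cn.ext P (S.Hf _ K.H3) (sw K.hwt)
  have gb : Cn P g K.c K.b β :=
    Cn.third S.hP cA.2.2.2.1 hβ (S.hneq K.EA.1 K.H1) hg hgbc hgA
  have gw : Cn P g K.d K.w ω :=
    Cn.third S.hP cd.2.2.2.1 hω (S.hneq K.Ed.1 K.H3) hg (sw gd.2.2.1) hgd
  refine ⟨g, ω, ?_, hω, hgH⟩
  rcases chain_six S.hP gb.symm gc gd gw with ⟨e, hp⟩ | h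
  · exfalso
    subst e
    have e13 := S.Hd _ K.H1 _ K.H3 _ _ _ (sw hβ.2.2.1) (sw hω.2.2.1)
    obtain ⟨β', hβ'⟩ := Cn.ext P hβ.1 hβ.2.2.1
    have h3 := sw hω.2.2.1
    rw [← e13] at h3
    rcases hβ'.det h3 with e | e
    · exact hp.ne.2.2.2.2.2.2.1 e.symm
    · rw [← e] at hβ'
      have := hβ'.uniq S.hP hp.cn.2.2.2.2.symm
      exact hgH (this ▸ K.H1)
  · exact h

theorem B3c.ne_fA (S : Sys P Q H M) (K : Core P Q H M u v) (hM : s(K.x2, K.x3) ∈ M)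
    (B : B3c P Q H K) : B.q ≠ K.fA ∧ B.X ≠ K.fA := by
  constructor
  · intro e
    have c := B.Pq.cn
    rw [e] at c
    exact (K.dist4 S).2.1 (K.fA_vert c.2.1.2.2.1 (S.exit_notH K.Ef)).symm
  · intro e
    have c := B.PX.cn
    rw [e] at c
    exact (K.dist6 S hM).1.1 (K.fA_vert c.1.2.1 (S.MH _ _ hM))

/-- Data about the face `Y` behind the edge `x2 x3`. -/
theorem B3c.facts (S : Sys P Q H M) (K : Core P Q H M u v) (hM : s(K.x2, K.x3) ∈ M)
    (B : B3c P Q H K) : Cn P K.h2 K.a K.a' B.a'' ∧ Cn P K.h3 K.t K.x1 B.x1' ∧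
    ∃ Y, Y ∉ H ∧ Cn P Y K.x3 K.x2 B.x2' ∧ Cn P Y K.x2 K.x3 B.a'' ∧
      (∀ r, Cn P K.h2 K.a' B.a'' r → Cn P Y K.x3 B.a'' r) ∧
      (∀ r, Cn P Y K.x2 B.x2' r → Cn P B.h4 B.c' B.x2' r) := by
  have cz := K.Pz.cn
  have cf := K.Pf.cn
  have cq := B.Pq.cn
  have cX := B.PX.cn
  have nz := K.Pz.ne
  have hqf : B.q ≠ K.f := by
    intro e
    have h := cq.2.1.2.1
    rw [e] at h
    rcases cf.2.2.1.det (sw h) with e | e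
    · exact B.Pq.ne.2.2.2.2.2.1 e
    · exact K.Pd.ne.2.1 e.symm
  refine ⟨⟨S.Hf _ K.H2, K.haa, B.haa2, ?_⟩, ⟨S.Hf _ K.H3, K.htx, B.hx1, ?_⟩, ?_⟩
  · intro e
    have c1 := cq.2.2.1
    rw [← e] at c1
    exact hqf (c1.symm.uniq S.hP cf.2.1)
  · intro e
    have c1 := cX.1
    rw [← e] at c1
    exact B.nX (c1.symm.uniq S.hP cz.2.1)
  obtain ⟨Y, hY, hYz, hYx, -⟩ := other_face P (S.Qf _ K.Ez.1) cz.2.2.1.2.2.1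
  have Y2 : Cn P Y K.x3 K.x2 B.x2' :=
    Cn.third S.hP cz.2.2.1 cX.2.2.2.2.symm B.nX.symm hY hYx hYz
  have Y3 : Cn P Y K.x2 K.x3 B.a'' :=
    Cn.third S.hP cz.2.2.2.1.symm cq.2.2.2.2.symm B.nq.symm hY (sw hYx) hYz
  have hYH : Y ∉ H := fun h => S.MH _ _ hM ⟨Y, h, _, hYx⟩
  have hYq : Y ≠ B.q := by
    intro e
    rw [e] at Y3
    exact nz.2.2.1 (Y3.symm.det' cq.2.2.2.2)
  have hYX : Y ≠ B.X := by
    intro e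
    rw [e] at Y2
    exact nz.2.2.2.2.2.2.2.2.1 (Y2.symm.det' cX.2.2.2.2)
  refine ⟨Y, hYH, Y2, Y3, ?_, ?_⟩
  · intro r hr
    exact Cn.third S.hP cq.2.2.2.1 hr (S.hneq B.qQ K.H2) hY (sw Y3.2.2.1) hYq
  · intro r hr
    exact Cn.third S.hP cX.2.2.2.1.symm hr hYX.symm (S.Hf _ B.H4) B.hxc (S.hneq B.XQ B.H4).symm

end

/-! ### Two configurations glued along an edge -/

/-- Separation of the two fragments. -/
def Sep (Q Q' : Finset (Finset (Sym2 V))) (fA fC : Finset (Sym2 V)) : Prop :=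
  ∀ f ∈ Q, ∀ g ∈ Q', ∀ x y z, s(x, y) ∈ f → s(x, z) ∈ g → f = fA ∧ g = fC

section
variable {P : PlaneGraph V} {Q H : Finset (Finset (Sym2 V))} {M : Finset (Sym2 V)} {u v : V}
  {Q' H' : Finset (Finset (Sym2 V))} {M' : Finset (Sym2 V)}

theorem same_b3 (S : Sys P Q H M) (S' : Sys P Q' H' M') (K : Core P Q H M u v)
    (L : Core P Q' H' M' u v) (hs : Sep Q Q' K.fA L.fA) (hne : K.fA ≠ L.fA)
    (hM : s(K.x2, K.x3) ∈ M) (B : B3c P Q H K) :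
    K.h2 = L.h2 ∧ Hexa P K.h2 B.a'' K.a' K.a v L.a L.a' := by
  have cA := K.PA.cn
  have lA := L.PA.cn
  have e1 : Cn P K.h2 K.a v L.a := Cn.third S.hP cA.2.1.symm lA.2.1.symm hne (S.Hf _ K.H2) K.hva
    (S.hneq K.EA.1 K.H2).symm
  have e2 : Cn P L.h2 L.a v K.a := Cn.third S.hP lA.2.1.symm cA.2.1.symm hne.symm (S'.Hf _ L.H2)
    L.hva (S'.hneq L.EA.1 L.H2).symm
  have e := e1.uniq S.hP e2.symm
  have l1 := (L.corners S').1
  rw [← e] at l1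
  exact ⟨e, hexa_of_chain (S.H6 _ K.H2) (B.facts S K hM).1.symm (K.corners S).1.symm e1 l1⟩

/-- Same side, both large. -/
theorem same33 (S : Sys P Q H M) (S' : Sys P Q' H' M') (K : Core P Q H M u v)
    (L : Core P Q' H' M' u v) (hs : Sep Q Q' K.fA L.fA) (hne : K.fA ≠ L.fA)
    (hM : s(K.x2, K.x3) ∈ M) (B : B3c P Q H K) (hM' : s(L.x2, L.x3) ∈ M') (B' : B3c P Q' H' L) :
    False := by
  obtain ⟨e, hh⟩ := same_b3 S S' K L hs hne hM B
  have h1 := (B'.facts S' L hM').1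
  rw [← e] at h1
  have e2 := hh.cn.2.2.2.2.1.det' h1
  have c1 := B.Pq.cn.2.2.2.1.2.2.1
  have c2 := B'.Pq.cn.2.2.2.1.2.2.1
  rw [e2] at c2
  exact (B.ne_fA S K hM).1 (hs _ B.qQ _ B'.qQ _ _ _ c1 c2).1

/-- Same side, one large. -/
theorem same32 (S : Sys P Q H M) (S' : Sys P Q' H' M') (K : Core P Q H M u v)
    (L : Core P Q' H' M' u v) (hs : Sep Q Q' K.fA L.fA) (hne : K.fA ≠ L.fA)
    (hM : s(K.x2, K.x3) ∈ M) (B : B3c P Q H K) : False := by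
  obtain ⟨e, hh⟩ := same_b3 S S' K L hs hne hM B
  obtain ⟨-, -, Y, hYH, Y2, Y3, Y4, -⟩ := B.facts S K hM
  obtain ⟨nf, nd, nz⟩ := L.ne_fA S'
  have lf := L.Pf.cn
  have ld := L.Pd.cn
  have lz := L.Pz.cn
  have y4 := Y4 _ hh.cn.2.2.2.2.2.symm
  have hY := y4.1
  have hYh : Y ≠ K.h2 := fun h => hYH (h ▸ K.H2)
  have y5 : Cn P Y B.a'' L.a' L.y :=
    Cn.third S.hP hh.cn.2.2.2.2.1 lf.2.1 (S'.hneq L.Ef.1 L.H2 ∘ fun h => (h.symm.trans e)) hY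
      (sw y4.2.2.1) hYh
  have hYf : Y ≠ L.f := by
    intro h
    have h1 := Y3.2.2.1
    rw [h] at h1
    exact nf (hs _ B.qQ _ L.Ef.1 _ _ _ B.Pq.cn.1.2.1 h1).2
  have y6 : Cn P Y L.a' L.y L.z :=
    Cn.third S.hP lf.2.2.1.symm ld.1 (L.pd_f S').symm hY (sw y5.2.2.1) hYf
  rcases chain_six S.hP Y2.symm Y3 y4 y5 with ⟨e, hp⟩ | hx
  · have h1 := lf.2.2.1.2.2.1
    rw [e] at h1
    exact nf (hs _ B.XQ _ L.Ef.1 _ _ _ B.PX.cn.2.2.2.1.2.2.1 h1).2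
  · have e := hx.cn.2.2.2.2.1.det' y6
    have h1 := lz.1.2.1
    rw [e] at h1
    exact nz (hs _ B.XQ _ L.Ez.1 _ _ _ B.PX.cn.2.2.2.1.2.2.1 h1).2

/-- Opposite sides: the common part. -/
theorem opp_b3 (S : Sys P Q H M) (S' : Sys P Q' H' M') (K : Core P Q H M u v)
    (L : Core P Q' H' M' v u) (hs : Sep Q Q' K.fA L.fA) (hne : K.fA ≠ L.fA)
    (hM : s(K.x2, K.x3) ∈ M) (B : B3c P Q H K) :
    K.h1 = L.h2 ∧ Cn P K.h1 K.b u L.a ∧ B.h4 = L.h3 ∧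
      ∃ γ, Hexa P B.h4 B.c' B.x2' γ L.w L.t L.x1 := by
  have cA := K.PA.cn
  have lA := L.PA.cn
  have e1 : Cn P K.h2 K.a v L.b := Cn.third S.hP cA.2.1.symm lA.2.2.1 hne (S.Hf _ K.H2) K.hva
    (S.hneq K.EA.1 K.H2).symm
  have e2 : Cn P L.h1 L.b v K.a := Cn.third S.hP lA.2.2.1 cA.2.1.symm hne.symm (S'.Hf _ L.H1)
    L.hub (S'.hneq L.EA.1 L.H1).symm
  have e := e1.uniq S.hP e2.symm
  have i1 : Cn P K.h1 K.b u L.a := Cn.third S.hP cA.2.2.1 lA.2.1.symm hne (S.Hf _ K.H1) K.hub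
    (S.hneq K.EA.1 K.H1).symm
  have i2 : Cn P L.h2 L.a u K.b := Cn.third S.hP lA.2.1.symm cA.2.2.1 hne.symm (S'.Hf _ L.H2)
    L.hva (S'.hneq L.EA.1 L.H2).symm
  refine ⟨i1.uniq S.hP i2.symm, i1, ?_⟩
  obtain ⟨k2, -, Y, hYH, Y2, Y3, Y4, Y5⟩ := B.facts S K hM
  obtain ⟨β, hβ⟩ := Cn.ext P e1.1 e1.2.2.1
  have hh : Hexa P K.h2 B.a'' K.a' K.a v L.b β :=
    hexa_of_chain (S.H6 _ K.H2) k2.symm (K.corners S).1.symm e1 hβ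
  have cb := hh.cn.2.2.2.2.1
  obtain ⟨γ, g1, g2, hγ⟩ := third_nbr P S.hP cb.2.2.2 cb.adj.1 cb.adj.2
  have hY := Y2.1
  have hYh : Y ≠ K.h2 := fun h => hYH (h ▸ K.H2)
  have y4 := Y4 _ hh.cn.2.2.2.2.2.symm
  have y5 : Cn P Y B.a'' β γ :=
    Cn.other S.hP cb hγ g1.symm g2.symm hY (sw y4.2.2.1) hYh
  rcases chain_six S.hP Y2.symm Y3 y4 y5 with ⟨ee, hp⟩ | hx
  · exfalso
    have h4 := Y5 _ hp.cn.2.2.2.2.symm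
    have e24 := S.Hd _ K.H2 _ B.H4 _ _ _ cb.2.2.1 (sw h4.2.2.1)
    have h5 := sw h4.2.2.1
    rw [← e24] at h5
    rcases cb.det h5 with h | h
    · exact g1 (h.symm.trans ee.symm)
    · exact g2 (h.symm.trans ee.symm)
  have h4 := Y5 _ hx.cn.2.2.2.2.2.symm
  have hβ' := hβ
  rw [e] at hβ'
  obtain ⟨g, ω, hg, hω, hgH⟩ := L.gface S' hβ'
  have hωγ : ω = γ := by
    have c1 := hg.cn.2.2.2.2.2
    rcases nbrs P S.hP cb.2.2.2 g1 g2 cb.adj.1 cb.adj.2 hγ c1.adj.1 with h | h | h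
    · exact absurd h.symm hg.ne.2.2.2.2.2.2.2.2.1
    · exfalso
      rw [h] at c1
      have := c1.symm.uniq S.hP cb
      rw [e] at this
      exact hgH (this ▸ L.H1)
    · exact h
  subst hωγ
  have gw := hg.cn.2.2.2.2.1
  have yw := hx.cn.2.2.2.2.1
  obtain ⟨nf, nd, nz⟩ := L.ne_fA S'
  have hYg : Y ≠ g := by
    intro h
    rw [← h] at gw
    have e3 := yw.det' gw.symm
    have h1 := L.Pd.cn.2.2.2.1.2.2.1
    rw [e3] at h1
    exact nd (hs _ B.XQ _ L.Ed.1 _ _ _ B.PX.cn.2.2.2.1.2.2.1 h1).2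
  have w1 : Cn P L.h3 L.w ω B.x2' :=
    Cn.third S.hP gw.symm yw hYg.symm hω.1 (sw hω.2.2.1) (fun h => hgH (h ▸ L.H3))
  have w2 : Cn P B.h4 B.x2' ω L.w :=
    Cn.third S.hP yw gw.symm hYg h4.1 (sw h4.2.2.1) (fun h => hYH (h ▸ B.H4))
  have e4 := w2.uniq S.hP w1.symm
  have l3 := (L.corners S').2
  rw [← e4] at hω l3
  exact ⟨e4, ω, hexa_of_chain (S.H6 _ B.H4) h4 w2 hω.symm l3⟩

theorem opp33 (S : Sys P Q H M) (S' : Sys P Q' H' M') (K : Core P Q H M u v)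
    (L : Core P Q' H' M' v u) (hs : Sep Q Q' K.fA L.fA) (hne : K.fA ≠ L.fA)
    (hM : s(K.x2, K.x3) ∈ M) (B : B3c P Q H K) (hM' : s(L.x2, L.x3) ∈ M') (B' : B3c P Q' H' L) :
    False := by
  obtain ⟨-, -, e, γ, hh⟩ := opp_b3 S S' K L hs hne hM B
  have h1 := (B'.facts S' L hM').2.1
  rw [← e] at h1
  have e2 := hh.cn.2.2.2.2.1.det' h1
  have c1 := B.PX.cn.2.2.1.2.2.1
  have c2 := B'.PX.cn.2.1.2.2.1
  rw [e2] at c2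
  exact (B.ne_fA S K hM).2 (hs _ B.XQ _ B'.XQ _ _ _ c1 c2).1

theorem opp32 (S : Sys P Q H M) (S' : Sys P Q' H' M') (K : Core P Q H M u v)
    (L : Core P Q' H' M' v u) (hs : Sep Q Q' K.fA L.fA) (hne : K.fA ≠ L.fA)
    (hM : s(K.x2, K.x3) ∈ M) (B : B3c P Q H K) {h5 : Finset (Sym2 V)} (H5 : h5 ∈ H')
    (hx5 : s(L.x2, L.x3) ∈ h5) : False := by
  obtain ⟨e12, i1, e, γ, hh⟩ := opp_b3 S S' K L hs hne hM B
  obtain ⟨nf, nd, nz⟩ := L.ne_fA S'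
  obtain ⟨-, k3, -⟩ := B.facts S K hM
  have cX := B.PX.cn
  have lf := L.Pf.cn
  have ld := L.Pd.cn
  have lz := L.Pz.cn
  have h4c := hh.cn
  obtain ⟨W, hW, hWz, hWx, -⟩ := other_face P (S'.Qf _ L.Ez.1) lz.2.1.2.2.1
  have W1 : Cn P W L.x2 L.x1 B.c' :=
    Cn.third S.hP lz.2.1 h4c.2.2.2.2.1 (fun h => S'.hneq L.Ez.1 L.H3 (h.trans e)) hW hWx hWz
  have hW4 : W ≠ B.h4 := by
    intro h
    rw [h] at W1
    exact L.Pz.ne.2.2.2.2.2.1 (W1.symm.det' h4c.2.2.2.2.1.symm)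
  have W2 : Cn P W L.x1 B.c' B.x1' :=
    Cn.third S.hP h4c.2.2.2.2.2.symm cX.2.2.1.symm (S.hneq B.XQ B.H4).symm hW (sw W1.2.2.1) hW4
  have hWX : W ≠ B.X := by
    intro h
    have h1 := W1.2.2.1
    rw [h] at h1
    exact nz (hs _ B.XQ _ L.Ez.1 _ _ _ h1 lz.2.1.2.2.1).2
  obtain ⟨ζ, hζ⟩ := Cn.ext P k3.1 k3.2.2.1
  have W3 : Cn P W B.c' B.x1' ζ :=
    Cn.third S.hP cX.2.1 hζ (S.hneq B.XQ K.H3) hW (sw W2.2.2.1) hWX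
  have hW3 : W ≠ K.h3 := by
    intro h
    rw [h] at W3
    exact B.PX.ne.2.2.2.2.2.1 (W3.symm.det' hζ.symm)
  obtain ⟨r, hr⟩ := Cn.ext P (S'.Hf _ H5) (sw hx5)
  have W4 : Cn P W L.x1 L.x2 r :=
    Cn.third S.hP lz.2.2.1.symm hr (S'.hneq L.Ez.1 H5) hW (sw hWx) hWz
  have hW5 : W ≠ h5 := by
    intro h
    rw [h] at W4
    exact L.Pz.ne.2.2.2.2.2.2.2.2.1 (hr.symm.det' W4.symm)
  obtain ⟨b', hb'⟩ := Cn.ext P i1.1 K.hub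
  obtain ⟨g, w', hg, hw', hgH⟩ := K.gface S hb'
  have hg3 : K.h3 ≠ g := fun h => hgH (h ▸ K.H3)
  have hg1 : g ≠ K.h1 := fun h => hgH (h ▸ K.H1)
  have gc := hg.cn
  have h3 : Hexa P K.h3 w' K.w K.t K.x1 B.x1' ζ :=
    hexa_of_chain (S.H6 _ K.H3) hw'.symm (K.corners S).2 k3 hζ
  have h3c := h3.cn
  have l2 := (L.corners S').1
  obtain ⟨θ, hθ⟩ := Cn.ext P l2.1 l2.2.2.1
  have l2' := l2
  have hθ' := hθ
  rw [← e12] at l2' hθ'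
  have h1 : Hexa P K.h1 b' K.b u L.a L.a' θ :=
    hexa_of_chain (S.H6 _ K.H1) hb'.symm i1 l2' hθ'
  have h1c := h1.cn
  have H1' : K.h1 ∈ H' := e12 ▸ L.H2
  rcases chain_six S.hP W4.symm W1 W2 W3 with ⟨ee, hp⟩ | hx
  · subst ee
    have hpc := hp.cn
    have a1 : Cn P h5 L.x2 ζ w' :=
      Cn.third S.hP hpc.2.2.2.2 h3c.2.2.2.2.1 hW3 hr.1 (sw hr.2.2.1) hW5.symm
    have h53 : h5 ≠ K.h3 := by
      intro h
      rw [h] at a1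
      have e3 := a1.symm.det' h3c.2.2.2.2.1.symm
      have c2 := cX.2.1.2.2.1
      rw [e3] at c2
      exact nz (hs _ B.XQ _ L.Ez.1 _ _ _ c2 lz.2.2.1.2.2.1).2
    have a2 : Cn P h5 ζ w' b' :=
      Cn.third S.hP h3c.2.2.2.2.2.symm gc.2.2.2.2.1 hg3 a1.1 (sw a1.2.2.1) h53
    have e5 := S'.Hd _ H5 _ H1' _ _ _ (sw a2.2.2.1) h1c.2.2.2.2.2.2.2.1
    have c3 := sw a2.2.2.1
    rw [e5] at c3
    rcases h1c.2.2.2.2.2.det c3 with h | h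
    · have c4 := gc.2.2.2.2.2
      rw [h] at c4
      exact hg1 (c4.uniq S.hP h1c.2.2.2.2.2)
    · exact hg.ne.2.2.2.2.2.2.2.2.1 h.symm
  have hxc := hx.cn
  obtain ⟨η, hη⟩ := Cn.ext P hr.1 hr.2.2.1
  obtain ⟨T, hT, hTW, hTx, -⟩ := other_face P hW hxc.2.2.2.2.1.2.2.1
  have T1 : Cn P T r ζ w' :=
    Cn.third S.hP hxc.2.2.2.2.1 h3c.2.2.2.2.1 hW3 hT hTx hTW
  have T2 : Cn P T ζ r η :=
    Cn.third S.hP hxc.2.2.2.2.2.symm hη hW5 hT (sw hTx) hTW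
  have hT3 : T ≠ K.h3 := by
    intro h
    rw [h] at T1
    exact hx.ne.2.2.2.1 (h3c.2.2.2.2.1.symm.det' T1.symm)
  have T3 : Cn P T ζ w' b' :=
    Cn.third S.hP h3c.2.2.2.2.2.symm gc.2.2.2.2.1 hg3 hT (sw T1.2.2.1) hT3
  have hTg : T ≠ g := by
    intro h
    rw [h] at T3
    exact h3.ne.2.2.2.2.2.2.2.2.1 (T3.symm.det' gc.2.2.2.2.1.symm)
  have T4 : Cn P T w' b' θ :=
    Cn.third S.hP gc.2.2.2.2.2.symm h1c.2.2.2.2.2.symm hg1 hT (sw T3.2.2.1) hTg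
  have hT1 : T ≠ K.h1 := by
    intro h
    rw [h] at T4
    exact hg.ne.2.2.2.2.2.2.2.2.1 (T4.symm.det' h1c.2.2.2.2.2)
  rcases chain_six S.hP T2.symm T1 T3 T4 with ⟨ee, hp⟩ | hy
  · subst ee
    have e5 := S'.Hd _ H5 _ H1' _ _ _ (sw hη.2.2.1) h1c.2.2.2.2.1.2.2.1
    have c3 := sw hη.2.2.1
    rw [e5] at c3
    rcases h1c.2.2.2.2.1.det c3 with h | h
    · have c4 := hp.cn.2.2.2.2
      rw [h] at c4
      exact hT1 (c4.symm.uniq S.hP h1c.2.2.2.2.1)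
    · exact hp.ne.2.2.2.2.2.2.1 h
  have hyc := hy.cn
  obtain ⟨k, hk, hkd, hky, -⟩ := other_face P (S'.Qf _ L.Ed.1) ld.1.2.2.1
  have k1 : Cn P k L.z L.y L.a' :=
    Cn.third S.hP ld.1 lf.2.2.1.symm (L.pd_f S') hk hky hkd
  have k2 : Cn P k L.y L.z L.x3 :=
    Cn.third S.hP ld.2.1.symm lz.2.2.2.2.symm (L.pz_pd S').symm hk (sw hky) hkd
  have hkf : k ≠ L.f := by
    intro h
    rw [h] at k1
    exact L.Pd.ne.2.1 (k1.symm.det' lf.2.2.1)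
  have hkH : k ∉ H' := fun h => S'.exit_notH L.Ef ⟨k, h, _, hky⟩
  have hkz : k ≠ L.pz := by
    intro h
    rw [h] at k2
    exact L.Pd.ne.2.2.2.2.2.1 (lz.2.2.2.2.det' k2.symm)
  have k3' : Cn P k L.y L.a' θ :=
    Cn.third S.hP lf.2.1 hθ (S'.hneq L.Ef.1 L.H2) hk (sw k1.2.2.1) hkf
  have k4 : Cn P k L.a' θ η :=
    Cn.third S.hP h1c.2.2.2.2.1.symm hyc.2.2.2.2.1 hT1.symm hk (sw k3'.2.2.1)
      (fun h => hkH (h ▸ H1'))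
  obtain ⟨p, hp⟩ := Cn.ext P hr.1 hx5
  have k5 : Cn P k L.z L.x3 p :=
    Cn.third S.hP lz.2.2.2.1 hp (S'.hneq L.Ez.1 H5) hk (sw k2.2.2.1) hkz
  obtain ⟨r', η', a, b, h6⟩ := hexa_of_edge P hr.1 (S'.H6 _ H5) hr.2.1
  have er := h6.cn.1.det' hr
  subst er
  have er := h6.cn.2.1.det' hη
  subst er
  rcases chain_six S.hP k4.symm k3'.symm k1.symm k2 with ⟨ee, -⟩ | hz
  · exact h6.ne.2.2.1 ee
  · have e7 := hz.cn.2.2.2.2.1.det' k5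
    have c5 := hp.2.2.1
    rw [e7] at c5
    rcases h6.cn.2.2.2.2.2.det c5 with h | h
    · exact h6.ne.2.2.2.2.2.2.2.2.2.2.2.2.2.1 h
    · exact h6.ne.2.2.2.2.2.2.1 h.symm

end

/-! ### The main argument -/

section
variable {P : PlaneGraph V} {Q H : Finset (Finset (Sym2 V))} {M : Finset (Sym2 V)} {u v : V}
  {Q' H' : Finset (Finset (Sym2 V))} {M' : Finset (Sym2 V)}

theorem edg_of (hP : IsFullerene P) (A C : Fragment P) {u v : V}
    (hAC : A.edges ∩ C.edges = {s(u, v)}) (hd : ∀ f ∈ A.inFaces, f ∉ C.inFaces)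
    {H : Finset (Finset (Sym2 V))} (hv : ∀ x : V, x ∈ s(u, v) → x ∈ facesVerts H)
    (hn : s(u, v) ∉ H.sup id) : Edg P A.inFaces H u v := by
  have hm : s(u, v) ∈ A.edges ∩ C.edges := by rw [hAC]; simp
  rw [Finset.mem_inter] at hm
  obtain ⟨f0, hf0, he0⟩ := mem_fragEdges.1 hm.1
  obtain ⟨g0, hg0, hk0⟩ := mem_fragEdges.1 hm.2
  have bd : ∀ f ∈ A.inFaces, ∀ g ∈ A.inFaces, s(u, v) ∈ f → s(u, v) ∈ g → f = g := by
    intro f hf g hg h1 h2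
    by_contra hne
    rcases two_faces P (A.subFaces hf) (A.subFaces hg) (C.subFaces hg0) h1 h2 hk0 hne with e | e
    · exact hd f hf (e ▸ hg0)
    · exact hd g hg (e ▸ hg0)
  refine ⟨bd, ⟨f0, hf0, he0⟩, mem_facesVerts.1 (hv u (by simp)), mem_facesVerts.1 (hv v (by simp)),
    ?_, ?_⟩
  · intro h hh he
    exact hn (Finset.mem_sup.2 ⟨h, hh, he⟩)
  · intro S h0 hS
    exact frag_conn hP A S hf0 (h0 f0 hf0 he0) he0 (fun g hg h => bd g hg f0 hf0 h he0) hS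

/-- The data of a large fragment. -/
theorem large (S : Sys P Q H M) (E : Edg P Q H u v) (hc : Q.card = 6) (K : Core P Q H M u v) :
    s(K.x2, K.x3) ∈ M ∧ Nonempty (B3c P Q H K) :=
  ⟨K.k6 S E hc, K.b3 S hc (K.k6 S E hc)⟩

theorem final_core (S : Sys P Q H M) (S' : Sys P Q' H' M') (E : Edg P Q H u v)
    (E' : Edg P Q' H' u v) (hc : Q.card = 6) (hc' : Q'.card = 4 ∨ Q'.card = 6)
    (hd : ∀ f ∈ Q, f ∉ Q')
    (hI : ∀ x y, (∃ f ∈ Q, s(x, y) ∈ f) → (∃ g ∈ Q', s(x, y) ∈ g) → s(x, y) = s(u, v))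
    (K : Core P Q H M u v) : False := by
  obtain ⟨hM, ⟨B⟩⟩ := large S E hc K
  have hsep : ∀ fC ∈ Q', s(u, v) ∈ fC → Sep Q Q' K.fA fC := by
    intro fC hfC huv f hf g hg x y z hx hz
    obtain ⟨w, hw1, hw2⟩ := share P S.hP (S.Qf f hf) (S'.Qf g hg) hx hz
    have e := hI x w ⟨f, hf, hw1⟩ ⟨g, hg, hw2⟩
    rw [e] at hw1 hw2
    exact ⟨E.bd f hf _ K.EA.1 hw1 (sw K.PA.cn.2.2.1.2.1), E'.bd g hg fC hfC hw2 huv⟩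
  rcases core_exists S' E' (by omega) with ⟨⟨L⟩⟩ | ⟨⟨L⟩⟩
  · have hs := hsep L.fA L.EA.1 (sw L.PA.cn.2.2.1.2.1)
    exact same32 S S' K L hs (fun h => hd _ K.EA.1 (h ▸ L.EA.1)) hM B
  · have hs := hsep L.fA L.EA.1 L.PA.cn.2.2.1.2.1
    have hne : K.fA ≠ L.fA := fun h => hd _ K.EA.1 (h ▸ L.EA.1)
    rcases hc' with h4 | h6
    · obtain ⟨h5, H5, hx⟩ := L.k4 S' h4
      exact opp32 S S' K L hs hne hM B H5 hx
    · obtain ⟨hM', ⟨B'⟩⟩ := large S' E'.symm h6 L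
      exact opp33 S S' K L hs hne hM B hM' B'

theorem final_pair (hP : IsFullerene P) (A C : Fragment P) (hA : IsB3Frag A)
    (hC : IsB2Frag C ∨ IsB3Frag C) {e : Sym2 V} (hAC : A.edges ∩ C.edges = {e})
    (pA : IsPastingEdge P A.edges e) (pC : IsPastingEdge P C.edges e) : False := by
  induction e using Sym2.ind with
  | _ u v =>
  have hcC : C.inFaces.card = 4 ∨ C.inFaces.card = 6 := by
    rcases hC with h | h
    · exact Or.inl h.2.1
    · exact Or.inr h.2.1
  have h5C : IsPentagonalFragment C := by
    rcases hC with h | h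
    · exact h.1
    · exact h.1
  have hxC : IsExtremalSub P C.edges := by
    rcases hC with h | h
    · exact h.2.2.1
    · exact h.2.2.1
  obtain ⟨-, H, hH, hv, hn⟩ := pA
  obtain ⟨-, H', hH', hv', hn'⟩ := pC
  obtain ⟨M, S⟩ := sys_of hP A hA.1 (by rw [hA.2.1]; norm_num) hA.2.2.1 hH
  obtain ⟨M', S'⟩ := sys_of hP C h5C (by omega) hxC hH'
  have hI : ∀ x y, (∃ f ∈ A.inFaces, s(x, y) ∈ f) → (∃ g ∈ C.inFaces, s(x, y) ∈ g) →
      s(x, y) = s(u, v) := by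
    intro x y h1 h2
    have : s(x, y) ∈ A.edges ∩ C.edges :=
      Finset.mem_inter.2 ⟨mem_fragEdges.2 h1, mem_fragEdges.2 h2⟩
    rw [hAC] at this
    simpa using this
  have hd : ∀ f ∈ A.inFaces, f ∉ C.inFaces := by
    intro f hf hf'
    have hsub : f ⊆ {s(u, v)} := by
      intro e he
      rw [← hAC]
      exact Finset.mem_inter.2 ⟨mem_fragEdges.2 ⟨f, hf, he⟩, mem_fragEdges.2 ⟨f, hf', he⟩⟩
    have h1 := Finset.card_le_card hsub
    rw [hA.1 f hf] at h1
    simp at h1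
  have E := edg_of hP A C hAC hd hv hn
  have E' := edg_of hP C A (by rw [Finset.inter_comm]; exact hAC) (fun f hf hf' => hd f hf' hf)
    hv' hn'
  rcases core_exists S E (by rw [hA.2.1]; norm_num) with ⟨⟨K⟩⟩ | ⟨⟨K⟩⟩
  · exact final_core S S' E E' hA.2.1 hcC hd hI K
  · exact final_core S S' E.symm E'.symm hA.2.1 hcC hd
      (fun x y h1 h2 => (hI x y h1 h2).trans Sym2.eq_swap) K

end

/-- Lemma 3.8. `B_2 ∗ B_3, B_3 ∗ B_3 ∉ 𝓑`: no fullerene graph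
contains a pentagonal fragment obtained by pasting `B_2` with `B_3`, or `B_3` with
`B_3`, along pasting edges. -/
theorem statement_11 (P : PlaneGraph V) (hP : IsFullerene P) (B A C : Fragment P)
    (h : (IsB2Frag A ∧ IsB3Frag C) ∨ (IsB3Frag A ∧ IsB3Frag C)) :
    ¬IsPasting B A C := by
  rintro ⟨-, e, hAC, pA, pC⟩
  rcases h with ⟨hA, hC⟩ | ⟨hA, hC⟩
  · exact final_pair hP C A hC (Or.inl hA) (by rw [Finset.inter_comm]; exact hAC) pC pA
  · exact final_pair hP A C hA (Or.inr hC) hAC pA pC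

end FG
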